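/- Suppose z ∈ ran( ∂f + Σ_{i=1}^m L_i*((K_i* ∘ ∂g_i ∘ K_i) □ (M_i* ∘ ∂l_i ∘ M_i))(L_i · − r_i) + ∇h ). Then for the sequences generated by the forward-backward-forward Algorithm 4.6 there exist an optimal solution x̄ to the primal problem (P) and an optimal solution (p̄, q̄) to the dual problem (D) such that x_n ⇀ x̄ and x̃_n ⇀ x̄ weakly in H, and for every i = 1,…,m both p_{i,n} ⇀ p̄_i and p̃_{i,n} ⇀ p̄_i weakly in X_i, and both q_{i,n} ⇀ q̄_i and q̃_{i,n} ⇀ q̄_i weakly in Y_i as n → +∞. -/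

import Mathlib

open scoped RealInnerProductSpace ENNReal
open Filter Topology

noncomputable section

/-- `f ∈ Γ(E)`: proper, convex and lower semicontinuous -/
def ProperConvLsc {E : Type*} [NormedAddCommGroup E] [InnerProductSpace ℝ E]
    (f : E → EReal) : Prop :=
  (∃ x, f x ≠ ⊤) ∧ (∀ x, f x ≠ ⊥) ∧
  (∀ x y : E, ∀ a b : ℝ, 0 ≤ a → 0 ≤ b → a + b = 1 →
    f (a • x + b • y) ≤ (a : EReal) * f x + (b : EReal) * f y) ∧
  LowerSemicontinuous f

/-- Fenchel conjugate -/
def econj {E : Type*} [NormedAddCommGroup E] [InnerProductSpace ℝ E]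
    (f : E → EReal) (p : E) : EReal :=
  ⨆ x : E, ((⟪p, x⟫ : ℝ) : EReal) - f x

/-- infimal convolution -/
def einfConv {E : Type*} [AddGroup E] (f g : E → EReal) (x : E) : EReal :=
  ⨅ y : E, f y + g (x - y)

/-- convex subdifferential -/
def esubdiff {E : Type*} [NormedAddCommGroup E] [InnerProductSpace ℝ E]
    (f : E → EReal) (x : E) : Set E :=
  {p | f x ≠ ⊤ ∧ f x ≠ ⊥ ∧ ∀ y, f x + ((⟪p, y - x⟫ : ℝ) : EReal) ≤ f y}

/-- effective domain -/
def edom {E : Type*} (f : E → EReal) : Set E := {x | f x ≠ ⊤}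

def invOp {E : Type*} (A : E → Set E) : E → Set E := fun u => {x | u ∈ A x}

def sumOp {E : Type*} [Add E] (A B : E → Set E) : E → Set E :=
  fun x => {s | ∃ u ∈ A x, ∃ v ∈ B x, s = u + v}

/-- parallel sum `A □ B = (A⁻¹ + B⁻¹)⁻¹` -/
def parOp {E : Type*} [Add E] (A B : E → Set E) : E → Set E :=
  invOp (sumOp (invOp A) (invOp B))

/-- `T* ∘ B ∘ T` -/
def compOp {F G : Type*} [NormedAddCommGroup F] [InnerProductSpace ℝ F] [CompleteSpace F]
    [NormedAddCommGroup G] [InnerProductSpace ℝ G] [CompleteSpace G]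
    (T : F →L[ℝ] G) (B : G → Set G) : F → Set F :=
  fun x => (ContinuousLinearMap.adjoint T) '' (B (T x))

/-- `x = Prox_{γ f}(w)`: `x` minimizes `u ↦ γ f(u) + ‖u - w‖²/2` -/
def IsProx {E : Type*} [NormedAddCommGroup E] [InnerProductSpace ℝ E]
    (γ : ℝ) (f : E → EReal) (w x : E) : Prop :=
  ∀ u : E, (γ : EReal) * f x + ((‖x - w‖ ^ 2 / 2 : ℝ) : EReal) ≤
    (γ : EReal) * f u + ((‖u - w‖ ^ 2 / 2 : ℝ) : EReal)

/-- weak convergence in a Hilbert space -/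
def WConv {E : Type*} [NormedAddCommGroup E] [InnerProductSpace ℝ E] (u : ℕ → E) (l : E) : Prop :=
  ∀ w : E, Tendsto (fun n => ⟪u n, w⟫) atTop (𝓝 ⟪l, w⟫)

/-- the objective value of the primal problem (P) -/
def Pval {m : ℕ}
    {H : Type*} [NormedAddCommGroup H] [InnerProductSpace ℝ H] [CompleteSpace H]
    {G : Fin m → Type*} [∀ i, NormedAddCommGroup (G i)] [∀ i, InnerProductSpace ℝ (G i)]
    [∀ i, CompleteSpace (G i)]
    {X : Fin m → Type*} [∀ i, NormedAddCommGroup (X i)] [∀ i, InnerProductSpace ℝ (X i)]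
    [∀ i, CompleteSpace (X i)]
    {Y : Fin m → Type*} [∀ i, NormedAddCommGroup (Y i)] [∀ i, InnerProductSpace ℝ (Y i)]
    [∀ i, CompleteSpace (Y i)]
    (z : H) (f : H → EReal) (h : H → ℝ)
    (g : ∀ i, X i → EReal) (l : ∀ i, Y i → EReal) (r : ∀ i, G i)
    (L : ∀ i, H →L[ℝ] G i) (K : ∀ i, G i →L[ℝ] X i) (M : ∀ i, G i →L[ℝ] Y i)
    (x : H) : EReal :=
  f x + (∑ i, einfConv (fun w => g i (K i w)) (fun w => l i (M i w)) (L i x - r i)) +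
    ((h x - ⟪x, z⟫ : ℝ) : EReal)

/-- the objective value of the dual problem (D) -/
def Dval {m : ℕ}
    {H : Type*} [NormedAddCommGroup H] [InnerProductSpace ℝ H] [CompleteSpace H]
    {G : Fin m → Type*} [∀ i, NormedAddCommGroup (G i)] [∀ i, InnerProductSpace ℝ (G i)]
    [∀ i, CompleteSpace (G i)]
    {X : Fin m → Type*} [∀ i, NormedAddCommGroup (X i)] [∀ i, InnerProductSpace ℝ (X i)]
    [∀ i, CompleteSpace (X i)]
    {Y : Fin m → Type*} [∀ i, NormedAddCommGroup (Y i)] [∀ i, InnerProductSpace ℝ (Y i)]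
    [∀ i, CompleteSpace (Y i)]
    (z : H) (f : H → EReal) (h : H → ℝ)
    (g : ∀ i, X i → EReal) (l : ∀ i, Y i → EReal) (r : ∀ i, G i)
    (L : ∀ i, H →L[ℝ] G i) (K : ∀ i, G i →L[ℝ] X i) (M : ∀ i, G i →L[ℝ] Y i)
    (p : ∀ i, X i) (q : ∀ i, Y i) : EReal :=
  - einfConv (econj f) (econj (fun x => (h x : EReal)))
      (z - ∑ i, ContinuousLinearMap.adjoint (L i) (ContinuousLinearMap.adjoint (K i) (p i)))
    - ∑ i, (econj (g i) (p i) + econj (l i) (q i) + ((⟪p i, K i (r i)⟫ : ℝ) : EReal))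

/-- Along the ultrafilter `U`, the sequence `u` converges weakly to `a`. -/
def UWConv {E : Type*} [NormedAddCommGroup E] [InnerProductSpace ℝ E] (U : Ultrafilter ℕ)
    (u : ℕ → E) (a : E) : Prop :=
  ∀ w : E, Tendsto (fun n => ⟪u n, w⟫) U (𝓝 ⟪a, w⟫)

section Weak

variable {E : Type*} [NormedAddCommGroup E] [InnerProductSpace ℝ E]

theorem exists_uWConv [CompleteSpace E] (U : Ultrafilter ℕ) (u : ℕ → E) {C : ℝ}
    (hC : ∀ᶠ n in (U : Filter ℕ), ‖u n‖ ≤ C) : ∃ a, UWConv U u a := by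
  have hcomp := WeakDual.isCompact_closedBall (𝕜 := ℝ) (0 : StrongDual ℝ E) C
  let φ : ℕ → WeakDual ℝ E := fun n => StrongDual.toWeakDual (InnerProductSpace.toDual ℝ E (u n))
  obtain ⟨x, -, hx⟩ := hcomp.ultrafilter_le_nhds (U.map φ) (by
    rw [Filter.le_principal_iff, Ultrafilter.mem_coe, Ultrafilter.mem_map]
    filter_upwards [hC] with n hn
    simpa [φ] using hn)
  have hx' : Tendsto φ U (𝓝 x) := hx
  refine ⟨(InnerProductSpace.toDual ℝ E).symm (WeakDual.toStrongDual x), fun w => ?_⟩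
  have h1 := ((WeakDual.eval_continuous (𝕜 := ℝ) w).tendsto x).comp hx'
  rw [InnerProductSpace.toDual_symm_apply]
  exact h1

/-- Opial's lemma. -/
theorem exists_wConv_of_opial [CompleteSpace E] (Z : Set E) (hZ : Z.Nonempty) (w : ℕ → E)
    (hconv : ∀ a ∈ Z, ∃ c, Tendsto (fun n => ‖w n - a‖) atTop (𝓝 c))
    (hclus : ∀ (U : Ultrafilter ℕ) (a : E), (U : Filter ℕ) ≤ atTop → UWConv U w a → a ∈ Z) :
    ∃ a ∈ Z, WConv w a := by
  obtain ⟨b, hb⟩ := hZ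
  obtain ⟨c, hc⟩ := hconv b hb
  have hbd : ∀ᶠ n in atTop, ‖w n‖ ≤ c + 1 + ‖b‖ := by
    filter_upwards [hc.eventually (gt_mem_nhds (lt_add_one c))] with n hn
    have := norm_le_norm_sub_add (w n) b
    linarith
  have hex : ∀ U : Ultrafilter ℕ, (U : Filter ℕ) ≤ atTop → ∃ a, UWConv U w a :=
    fun U hU => exists_uWConv U w (hU hbd)
  have huniq : ∀ (U V : Ultrafilter ℕ) (a a' : E), (U : Filter ℕ) ≤ atTop →
      (V : Filter ℕ) ≤ atTop → UWConv U w a → UWConv V w a' → a = a' := by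
    intro U V a a' hU hV ha ha'
    obtain ⟨c1, h1⟩ := hconv a (hclus U a hU ha)
    obtain ⟨c2, h2⟩ := hconv a' (hclus V a' hV ha')
    have hid : ∀ n, ⟪w n, a - a'⟫ =
        (‖w n - a'‖ ^ 2 - ‖w n - a‖ ^ 2 + ‖a‖ ^ 2 - ‖a'‖ ^ 2) / 2 := by
      intro n
      rw [norm_sub_sq_real, norm_sub_sq_real, inner_sub_right]
      ring
    have hlim : Tendsto (fun n => ⟪w n, a - a'⟫) atTop
        (𝓝 ((c2 ^ 2 - c1 ^ 2 + ‖a‖ ^ 2 - ‖a'‖ ^ 2) / 2)) := by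
      simp_rw [hid]
      exact ((((h2.pow 2).sub (h1.pow 2)).add_const _).sub_const _).div_const _
    have e1 := tendsto_nhds_unique (ha (a - a')) (hlim.mono_left hU)
    have e2 := tendsto_nhds_unique (ha' (a - a')) (hlim.mono_left hV)
    have : ⟪a - a', a - a'⟫ = 0 := by rw [inner_sub_left, e1, e2, sub_self]
    exact sub_eq_zero.mp (inner_self_eq_zero.mp this)
  let U₀ : Ultrafilter ℕ := Ultrafilter.of atTop
  have hU₀ : (U₀ : Filter ℕ) ≤ atTop := Ultrafilter.of_le atTop
  obtain ⟨a, ha⟩ := hex U₀ hU₀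
  refine ⟨a, hclus U₀ a hU₀ ha, fun y => ?_⟩
  rw [tendsto_iff_ultrafilter]
  intro V hV
  obtain ⟨a', ha'⟩ := hex V hV
  rw [huniq U₀ V a a' hU₀ hV ha ha']
  exact ha' y

theorem WConv.of_norm_sub {u v : ℕ → E} {a : E} (hu : WConv u a)
    (huv : Tendsto (fun n => ‖v n - u n‖) atTop (𝓝 0)) : WConv v a := by
  intro w
  have h1 : Tendsto (fun n => ⟪v n - u n, w⟫) atTop (𝓝 0) := by
    refine squeeze_zero_norm (fun n => norm_inner_le_norm _ _) ?_
    simpa using huv.mul_const ‖w‖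
  simpa [inner_sub_left] using h1.add (hu w)

theorem UWConv.of_norm_sub {U : Ultrafilter ℕ} {u v : ℕ → E} {a : E} (hu : UWConv U u a)
    (huv : Tendsto (fun n => ‖v n - u n‖) U (𝓝 0)) : UWConv U v a := by
  intro w
  have h1 : Tendsto (fun n => ⟪v n - u n, w⟫) U (𝓝 0) := by
    refine squeeze_zero_norm (fun n => norm_inner_le_norm _ _) ?_
    simpa using huv.mul_const ‖w‖
  simpa [inner_sub_left] using h1.add (hu w)

theorem tendsto_inner_zero {U : Ultrafilter ℕ} {u v : ℕ → E} {C : ℝ}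
    (hu : Tendsto u U (𝓝 0)) (hv : ∀ n, ‖v n‖ ≤ C) :
    Tendsto (fun n => ⟪u n, v n⟫) U (𝓝 0) := by
  refine squeeze_zero_norm (a := fun n => ‖u n‖ * C) (fun n => (norm_inner_le_norm _ _).trans
    (mul_le_mul_of_nonneg_left (hv n) (norm_nonneg _))) ?_
  simpa using hu.norm.mul_const C

theorem tendsto_of_le_add_summable {a e : ℕ → ℝ} (ha : ∀ n, 0 ≤ a n)
    (he : ∀ n, 0 ≤ e n) (hs : Summable e) (h : ∀ n, a (n + 1) ≤ a n + e n) :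
    ∃ c, Tendsto a atTop (𝓝 c) := by
  let b : ℕ → ℝ := fun n => a n - ∑ k ∈ Finset.range n, e k
  have hb : Antitone b := antitone_nat_of_succ_le fun n => by
    simp only [b, Finset.sum_range_succ]
    linarith [h n]
  have hbd : BddBelow (Set.range b) := by
    refine ⟨-∑' k, e k, ?_⟩
    rintro _ ⟨n, rfl⟩
    have := hs.sum_le_tsum (Finset.range n) (fun k _ => he k)
    simp only [b]
    linarith [ha n]
  refine ⟨_, ((tendsto_atTop_ciInf hb hbd).add hs.hasSum.tendsto_sum_nat).congr fun n => ?_⟩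
  simp [b]

/-- Weak convergence of the forward-backward-forward iteration with summable errors; `R w u`
stands for `u ∈ (A + Q) w`. -/
theorem exists_wConv_of_forward_backward_forward [CompleteSpace E] {w J : ℕ → E} {Q : E → E}
    {R : E → E → Prop} {β ε : ℝ} {γ : ℕ → ℝ} (hε : 0 < ε) (hε1 : ε < 1)
    (hγ : ∀ n, ε ≤ γ n) (hγβ : ∀ n, γ n * β ≤ 1 - ε)
    (hQ : ∀ a b, ‖Q a - Q b‖ ≤ β * ‖a - b‖)
    (hR : ∀ n, R (J n) ((γ n)⁻¹ • (w n - J n) - (Q (w n) - Q (J n))))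
    (hmono : ∀ a b u, R a u → R b 0 → 0 ≤ ⟪u, a - b⟫)
    (hclosed : ∀ (U : Ultrafilter ℕ) (a u : ℕ → E) (b : E) (C : ℝ), (∀ n, ‖a n‖ ≤ C) →
      (∀ n, R (a n) (u n)) → Tendsto u U (𝓝 0) → UWConv U a b → R b 0)
    (hne : ∃ a, R a 0)
    (hw : Summable fun n => ‖w (n + 1) - (J n + γ n • (Q (w n) - Q (J n)))‖) :
    ∃ a, R a 0 ∧ WConv w a ∧ WConv J a := by
  let D : ℕ → E := fun n => (γ n)⁻¹ • (w n - J n) - (Q (w n) - Q (J n))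
  let T : ℕ → E := fun n => J n + γ n • (Q (w n) - Q (J n))
  let e : ℕ → ℝ := fun n => ‖w (n + 1) - T n‖
  have he : Tendsto e atTop (𝓝 0) := hw.tendsto_atTop_zero
  have hγ0 : ∀ n, 0 < γ n := fun n => hε.trans_le (hγ n)
  have hTD : ∀ n, T n = w n - γ n • D n := fun n => by
    simp only [T, D, smul_sub, smul_inv_smul₀ (hγ0 n).ne']
    abel
  have hest : ∀ a, R a 0 → ∀ n, ‖T n - a‖ ^ 2 ≤ ‖w n - a‖ ^ 2 - ε * ‖w n - J n‖ ^ 2 := by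
    intro a ha n
    have h1 := hmono _ _ _ (hR n) ha
    change 0 ≤ ⟪D n, J n - a⟫ at h1
    have h2 : ‖T n - a‖ ^ 2 = ‖w n - a‖ ^ 2 - 2 * γ n * ⟪D n, J n - a⟫
        - ‖w n - J n‖ ^ 2 + ‖γ n • (Q (w n) - Q (J n))‖ ^ 2 := by
      have e1 : γ n • (Q (w n) - Q (J n)) = (w n - J n) - γ n • D n := by
        simp only [D, smul_sub, smul_inv_smul₀ (hγ0 n).ne']
        abel
      have e2 : T n - a = (w n - a) - γ n • D n := by rw [hTD]; abel
      have e3 : J n - a = (w n - a) - (w n - J n) := by abel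
      rw [e1, e2, e3, norm_sub_sq_real (w n - a), norm_sub_sq_real (w n - J n), inner_sub_right,
        inner_smul_right, inner_smul_right, real_inner_comm (D n), real_inner_comm (D n)]
      ring
    have h3 : ‖γ n • (Q (w n) - Q (J n))‖ ≤ (1 - ε) * ‖w n - J n‖ := by
      rw [norm_smul, Real.norm_of_nonneg (hγ0 n).le]
      calc γ n * ‖Q (w n) - Q (J n)‖ ≤ γ n * (β * ‖w n - J n‖) :=
            mul_le_mul_of_nonneg_left (hQ _ _) (hγ0 n).le
        _ = γ n * β * ‖w n - J n‖ := by ring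
        _ ≤ _ := mul_le_mul_of_nonneg_right (hγβ n) (norm_nonneg _)
    have h4 : ‖γ n • (Q (w n) - Q (J n))‖ ^ 2 ≤ (1 - ε) ^ 2 * ‖w n - J n‖ ^ 2 := by
      rw [← mul_pow]
      exact pow_le_pow_left₀ (norm_nonneg _) h3 2
    have h5 : 0 ≤ γ n * ⟪D n, J n - a⟫ := mul_nonneg (hγ0 n).le h1
    have h6 : 0 ≤ ε * (1 - ε) * ‖w n - J n‖ ^ 2 := by
      have : 0 ≤ 1 - ε := by linarith
      positivity
    nlinarith
  have hle : ∀ a, R a 0 → ∀ n, ‖T n - a‖ ≤ ‖w n - a‖ := fun a ha n =>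
    le_of_sq_le_sq (by nlinarith [hest a ha n, sq_nonneg ‖w n - J n‖]) (norm_nonneg _)
  have hstep : ∀ a n, ‖w (n + 1) - a‖ ≤ ‖T n - a‖ + e n := fun a n => by
    have := norm_add_le (w (n + 1) - T n) (T n - a)
    rw [sub_add_sub_cancel] at this
    linarith
  have hconv : ∀ a, R a 0 → ∃ c, Tendsto (fun n => ‖w n - a‖) atTop (𝓝 c) := fun a ha =>
    tendsto_of_le_add_summable (fun n => norm_nonneg _) (fun n => norm_nonneg _) hw
      fun n => (hstep a n).trans (by linarith [hle a ha n])
  obtain ⟨b, hb⟩ := hne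
  obtain ⟨c, hc⟩ := hconv b hb
  have hTc : Tendsto (fun n => ‖T n - b‖) atTop (𝓝 c) := by
    have hc1 := (tendsto_add_atTop_iff_nat 1).mpr hc
    refine tendsto_of_tendsto_of_tendsto_of_le_of_le (g := fun n => ‖w (n + 1) - b‖ - e n)
      (by simpa using hc1.sub he) hc (fun n => by linarith [hstep b n]) (fun n => hle b hb n)
  have hwJ : Tendsto (fun n => ‖w n - J n‖) atTop (𝓝 0) := by
    have h1 : Tendsto (fun n => (‖w n - b‖ ^ 2 - ‖T n - b‖ ^ 2) / ε) atTop (𝓝 0) := by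
      simpa using ((hc.pow 2).sub (hTc.pow 2)).div_const ε
    have h2 : Tendsto (fun n => ‖w n - J n‖ ^ 2) atTop (𝓝 0) := by
      refine squeeze_zero (fun n => by positivity) (fun n => ?_) h1
      rw [le_div_iff₀ hε]
      linarith [hest b hb n]
    simpa [Real.sqrt_sq] using h2.sqrt
  have hD : Tendsto D atTop (𝓝 0) := by
    refine squeeze_zero_norm (a := fun n => (ε⁻¹ + β) * ‖w n - J n‖) (fun n => ?_)
      (by simpa using hwJ.const_mul (ε⁻¹ + β))
    refine (norm_sub_le _ _).trans ?_
    rw [add_mul, norm_smul, Real.norm_of_nonneg (inv_pos.mpr (hγ0 n)).le]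
    exact add_le_add (mul_le_mul_of_nonneg_right (inv_anti₀ hε (hγ n)) (norm_nonneg _)) (hQ _ _)
  have hJw : Tendsto (fun n => ‖J n - w n‖) atTop (𝓝 0) := by
    simpa only [norm_sub_rev] using hwJ
  obtain ⟨C, hC⟩ : ∃ C, ∀ n, ‖J n‖ ≤ C := by
    obtain ⟨C1, h1⟩ := hc.bddAbove_range
    obtain ⟨C2, h2⟩ := hJw.bddAbove_range
    refine ⟨C2 + C1 + ‖b‖, fun n => ?_⟩
    have := norm_add₃_le (a := J n - w n) (b := w n - b) (c := b)
    rw [sub_add_sub_cancel, sub_add_cancel] at this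
    linarith [h1 ⟨n, rfl⟩, h2 ⟨n, rfl⟩]
  obtain ⟨a, ha, hwa⟩ := exists_wConv_of_opial {a | R a 0} ⟨b, hb⟩ w hconv
    fun U a hU hUa => hclosed U J D a C hC hR (hD.mono_left hU)
      (hUa.of_norm_sub (hJw.mono_left hU))
  exact ⟨a, ha, hwa, hwa.of_norm_sub hJw⟩

end Weak

section Convex

variable {E : Type*} [NormedAddCommGroup E] [InnerProductSpace ℝ E]

/-- `φ` is the pointwise supremum of its continuous affine minorants. -/
def HasAffineMinorants (φ : E → EReal) : Prop :=
  ∀ (x : E) (t : ℝ), (t : EReal) < φ x →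
    ∃ (c : E) (α : ℝ), t < ⟪c, x⟫ + α ∧ ∀ y, ((⟪c, y⟫ + α : ℝ) : EReal) ≤ φ y

theorem EReal.exists_coe_eq {a : EReal} (h1 : a ≠ ⊤) (h2 : a ≠ ⊥) : ∃ r : ℝ, a = r :=
  ⟨a.toReal, (EReal.coe_toReal h1 h2).symm⟩

theorem mem_esubdiff_iff {φ : E → EReal} {x u : E} :
    u ∈ esubdiff φ x ↔ ∃ a : ℝ, φ x = a ∧ ∀ y, ((a + ⟪u, y - x⟫ : ℝ) : EReal) ≤ φ y := by
  constructor
  · rintro ⟨h1, h2, h3⟩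
    obtain ⟨a, ha⟩ := EReal.exists_coe_eq h1 h2
    exact ⟨a, ha, fun y => by simpa [ha] using h3 y⟩
  · rintro ⟨a, ha, h⟩
    exact ⟨by simp [ha], by simp [ha], fun y => by simpa [ha] using h y⟩

theorem esubdiff_monotone {φ : E → EReal} {x x' u u' : E} (hu : u ∈ esubdiff φ x)
    (hu' : u' ∈ esubdiff φ x') : 0 ≤ ⟪u - u', x - x'⟫ := by
  obtain ⟨a, ha, h⟩ := mem_esubdiff_iff.mp hu
  obtain ⟨a', ha', h'⟩ := mem_esubdiff_iff.mp hu'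
  have h1 := h x'
  have h2 := h' x
  rw [ha', EReal.coe_le_coe_iff] at h1
  rw [ha, EReal.coe_le_coe_iff] at h2
  simp only [inner_sub_left, inner_sub_right] at *
  linarith

theorem le_econj {φ : E → EReal} {x : E} {a : ℝ} (ha : φ x = a) (p : E) :
    ((⟪p, x⟫ - a : ℝ) : EReal) ≤ econj φ p := by
  refine le_trans (le_of_eq ?_) (le_iSup (fun x => ((⟪p, x⟫ : ℝ) : EReal) - φ x) x)
  simp [ha]

theorem econj_le_of_forall {φ : E → EReal} {p : E} {b : ℝ}
    (h : ∀ y, ((⟪p, y⟫ - b : ℝ) : EReal) ≤ φ y) : econj φ p ≤ b := by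
  refine iSup_le fun y => ?_
  rcases eq_or_ne (φ y) ⊤ with hy | hy
  · simp [hy]
  · obtain ⟨a, ha⟩ := EReal.exists_coe_eq hy
      (ne_of_gt (lt_of_lt_of_le (EReal.bot_lt_coe _) (h y)))
    have := h y
    rw [ha] at this ⊢
    rw [← EReal.coe_sub]
    rw [EReal.coe_le_coe_iff] at *
    linarith

theorem econj_eq_of_mem_esubdiff {φ : E → EReal} {x u : E} {a : ℝ} (ha : φ x = a)
    (hu : u ∈ esubdiff φ x) : econj φ u = ((⟪u, x⟫ - a : ℝ) : EReal) := by
  refine le_antisymm (econj_le_of_forall fun y => ?_) (le_econj ha u)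
  have := hu.2.2 y
  rw [ha, ← EReal.coe_add] at this
  refine le_trans (le_of_eq ?_) this
  rw [inner_sub_right]
  congr 1
  ring

theorem mem_esubdiff_econj {φ : E → EReal} {x u : E} (hu : u ∈ esubdiff φ x) :
    x ∈ esubdiff (econj φ) u := by
  obtain ⟨a, ha, -⟩ := mem_esubdiff_iff.mp hu
  refine mem_esubdiff_iff.mpr ⟨_, econj_eq_of_mem_esubdiff ha hu, fun y => ?_⟩
  refine le_trans (le_of_eq ?_) (le_econj ha y)
  rw [inner_sub_right, real_inner_comm u, real_inner_comm y]
  congr 1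
  ring

theorem HasAffineMinorants.mem_esubdiff_of_econj {φ : E → EReal} (hφ : HasAffineMinorants φ)
    (hbot : ∀ x, φ x ≠ ⊥) {x p : E} (hx : x ∈ esubdiff (econj φ) p) : p ∈ esubdiff φ x := by
  obtain ⟨b, hb, h⟩ := mem_esubdiff_iff.mp hx
  have hle : φ x ≤ ((⟪p, x⟫ - b : ℝ) : EReal) := by
    by_contra! hlt
    obtain ⟨c, α, h1, h2⟩ := hφ x _ hlt
    have h3 : econj φ c ≤ ((-α : ℝ) : EReal) :=
      econj_le_of_forall fun y => by simpa using h2 y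
    have h4 := (h c).trans h3
    rw [EReal.coe_le_coe_iff, inner_sub_right, real_inner_comm c, real_inner_comm p] at h4
    linarith
  obtain ⟨a, ha⟩ := EReal.exists_coe_eq (ne_of_lt (hle.trans_lt (EReal.coe_lt_top _))) (hbot x)
  refine mem_esubdiff_iff.mpr ⟨a, ha, fun y => ?_⟩
  rcases eq_or_ne (φ y) ⊤ with hy | hy
  · simp [hy]
  · obtain ⟨d, hd⟩ := EReal.exists_coe_eq hy (hbot y)
    have h5 := le_econj hd p
    rw [hb, EReal.coe_le_coe_iff] at h5
    rw [ha, EReal.coe_le_coe_iff] at hle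
    rw [hd, EReal.coe_le_coe_iff, inner_sub_right]
    linarith

theorem hasAffineMinorants_econj {φ : E → EReal} (hbot : ∀ x, φ x ≠ ⊥) :
    HasAffineMinorants (econj φ) := by
  intro p t ht
  obtain ⟨x, hx⟩ := lt_iSup_iff.mp ht
  rcases eq_or_ne (φ x) ⊤ with hy | hy
  · simp [hy] at hx
  · obtain ⟨a, ha⟩ := EReal.exists_coe_eq hy (hbot x)
    rw [ha, ← EReal.coe_sub, EReal.coe_lt_coe_iff] at hx
    refine ⟨x, -a, ?_, fun y => ?_⟩
    · rw [real_inner_comm]; linarith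
    · have := le_econj ha y
      rwa [real_inner_comm, ← sub_eq_add_neg]

theorem econj_ne_bot {φ : E → EReal} (hp : ∃ x, φ x ≠ ⊤) (hbot : ∀ x, φ x ≠ ⊥) (p : E) :
    econj φ p ≠ ⊥ := by
  obtain ⟨x, hx⟩ := hp
  obtain ⟨a, ha⟩ := EReal.exists_coe_eq hx (hbot x)
  exact ne_of_gt (lt_of_lt_of_le (EReal.bot_lt_coe _) (le_econj ha p))

theorem HasAffineMinorants.le_of_convex_comb {φ : E → EReal} (hφ : HasAffineMinorants φ)
    {x y : E} {a b s t : ℝ} (hx : φ x = a) (hy : φ y = b) (hs : 0 ≤ s) (ht : 0 ≤ t)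
    (hst : s + t = 1) : φ (s • x + t • y) ≤ ((s * a + t * b : ℝ) : EReal) := by
  by_contra! hlt
  obtain ⟨c, α, h1, h2⟩ := hφ _ _ hlt
  have h3 := h2 x
  have h4 := h2 y
  rw [hx, EReal.coe_le_coe_iff] at h3
  rw [hy, EReal.coe_le_coe_iff] at h4
  rw [inner_add_right, inner_smul_right, inner_smul_right] at h1
  have : α = s * α + t * α := by rw [← add_mul, hst, one_mul]
  nlinarith [mul_le_mul_of_nonneg_left h3 hs, mul_le_mul_of_nonneg_left h4 ht]

/-- The Fenchel-Moreau theorem, stated through affine minorants. -/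
theorem ProperConvLsc.hasAffineMinorants [CompleteSpace E] {φ : E → EReal} (hφ : ProperConvLsc φ) :
    HasAffineMinorants φ := by
  obtain ⟨⟨x₁, hx₁⟩, hbot, hconv, hlsc⟩ := hφ
  obtain ⟨a₁, ha₁⟩ := EReal.exists_coe_eq hx₁ (hbot x₁)
  let C : Set (E × ℝ) := {w | φ w.1 ≤ (w.2 : EReal)}
  have hCconv : Convex ℝ C := by
    intro w hw w' hw' s t hs ht hst
    change φ w.1 ≤ _ at hw
    change φ w'.1 ≤ _ at hw'
    change φ (s • w.1 + t • w'.1) ≤ ((s • w.2 + t • w'.2 : ℝ) : EReal)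
    refine (hconv _ _ s t hs ht hst).trans ?_
    rw [smul_eq_mul, smul_eq_mul, EReal.coe_add, EReal.coe_mul, EReal.coe_mul]
    exact add_le_add (mul_le_mul_of_nonneg_left hw (by exact_mod_cast hs))
      (mul_le_mul_of_nonneg_left hw' (by exact_mod_cast ht))
  have hCclosed : IsClosed C := by
    have h1 : IsClosed {w : E × EReal | φ w.1 ≤ w.2} := hlsc.isClosed_epigraph
    exact h1.preimage (continuous_fst.prodMk (continuous_coe_real_ereal.comp continuous_snd))
  have hsep : ∀ (x : E) (t : ℝ), (t : EReal) < φ x → ∃ (c : E →L[ℝ] ℝ) (k u : ℝ),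
      c x + k * t < u ∧ 0 ≤ k ∧ ∀ (y : E) (s : ℝ), φ y ≤ s → u < c y + k * s := by
    intro x t ht
    obtain ⟨F, u, h1, h2⟩ := geometric_hahn_banach_point_closed (x := (x, t)) hCconv hCclosed
      (by simpa [C] using ht)
    have hF : ∀ (y : E) (s : ℝ), F (y, s) = F (y, 0) + F (0, 1) * s := fun y s => by
      have : ((y, s) : E × ℝ) = (y, 0) + s • (0, 1) := by simp
      rw [this, map_add, map_smul, smul_eq_mul, mul_comm]
    refine ⟨F.comp (ContinuousLinearMap.inl ℝ E ℝ), F (0, 1), u, ?_, ?_, ?_⟩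
    · rw [hF] at h1; simpa using h1
    · by_contra! hk
      have h3 : ∀ s : ℝ, a₁ ≤ s → u < F (x₁, 0) + F (0, 1) * s := fun s hs => by
        rw [← hF]
        exact h2 _ (by simpa [C, ha₁] using hs)
      have h4 := h3 (max a₁ ((u - F (x₁, 0)) / F (0, 1))) (le_max_left _ _)
      have h5 := mul_le_mul_of_nonpos_left
        (le_max_right a₁ ((u - F (x₁, 0)) / F (0, 1))) hk.le
      rw [mul_div_cancel₀ _ hk.ne] at h5
      linarith
    · intro y s hs
      have := h2 (y, s) hs
      rw [hF] at this
      simpa using this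
  have hpos : ∀ (c : E →L[ℝ] ℝ) (k u : ℝ), 0 < k →
      (∀ (y : E) (s : ℝ), φ y ≤ s → u < c y + k * s) →
      ∀ y, ((((-k⁻¹) • c) y + u / k : ℝ) : EReal) ≤ φ y := by
    intro c k u hk h y
    rcases eq_or_ne (φ y) ⊤ with hy | hy
    · simp [hy]
    · obtain ⟨s, hs⟩ := EReal.exists_coe_eq hy (hbot y)
      have := h y s hs.le
      rw [hs, EReal.coe_le_coe_iff, smul_apply, smul_eq_mul,
        show -k⁻¹ * c y + u / k = (u - c y) / k by field_simp; ring, div_le_iff₀ hk]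
      linarith
  have hpos' : ∀ (c : E →L[ℝ] ℝ) (k u t : ℝ) (x : E), 0 < k → c x + k * t < u →
      t < ((-k⁻¹) • c) x + u / k := by
    intro c k u t x hk h
    rw [smul_apply, smul_eq_mul,
        show -k⁻¹ * c x + u / k = (u - c x) / k by field_simp; ring, lt_div_iff₀ hk]
    linarith
  obtain ⟨c₀, α₀, h₀⟩ : ∃ (c : E →L[ℝ] ℝ) (α : ℝ), ∀ y, ((c y + α : ℝ) : EReal) ≤ φ y := by
    obtain ⟨c, k, u, h1, hk, h2⟩ := hsep x₁ (a₁ - 1) (by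
      rw [ha₁, EReal.coe_lt_coe_iff]; linarith)
    have h3 := h2 x₁ a₁ ha₁.le
    exact ⟨_, _, hpos c k u (by linarith) h2⟩
  intro x t ht
  suffices ∃ (c : E →L[ℝ] ℝ) (α : ℝ), t < c x + α ∧ ∀ y, ((c y + α : ℝ) : EReal) ≤ φ y by
    obtain ⟨c, α, h1, h2⟩ := this
    exact ⟨(InnerProductSpace.toDual ℝ E).symm c, α, by simpa using h1, by simpa using h2⟩
  obtain ⟨c, k, u, h1, hk, h2⟩ := hsep x t ht
  rcases hk.eq_or_lt with rfl | hk
  · have hd : 0 < u - c x := by linarith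
    let n : ℝ := (|t - (c₀ x + α₀)| + 1) / (u - c x)
    have hn : 0 ≤ n := by positivity
    have hnd : n * (u - c x) = |t - (c₀ x + α₀)| + 1 := div_mul_cancel₀ _ hd.ne'
    refine ⟨c₀ - n • c, α₀ + n * u, ?_, fun y => ?_⟩
    · simp only [sub_apply, smul_apply, smul_eq_mul]
      nlinarith [le_abs_self (t - (c₀ x + α₀))]
    · rcases eq_or_ne (φ y) ⊤ with hy | hy
      · simp [hy]
      · obtain ⟨s, hs⟩ := EReal.exists_coe_eq hy (hbot y)
        refine le_trans ?_ (h₀ y)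
        have h3 := h2 y s hs.le
        rw [EReal.coe_le_coe_iff, sub_apply, smul_apply,
          smul_eq_mul]
        nlinarith [mul_nonneg hn (show 0 ≤ c y - u by linarith)]
  · exact ⟨_, _, hpos' c k u t x hk h1, hpos c k u hk h2⟩

theorem mem_esubdiff_of_isProx {φ : E → EReal} (hφ : HasAffineMinorants φ)
    (hbot : ∀ x, φ x ≠ ⊥) (hp : ∃ x, φ x ≠ ⊤) {γ : ℝ} (hγ : 0 < γ) {w j : E}
    (h : IsProx γ φ w j) : γ⁻¹ • (w - j) ∈ esubdiff φ j := by
  have hreal : ∀ (u : E) (b : ℝ), φ u ≤ b →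
      (γ : EReal) * φ j + ((‖j - w‖ ^ 2 / 2 : ℝ) : EReal) ≤
        ((γ * b + ‖u - w‖ ^ 2 / 2 : ℝ) : EReal) := by
    intro u b hb
    rw [EReal.coe_add, EReal.coe_mul]
    exact (h u).trans (add_le_add
      (mul_le_mul_of_nonneg_left hb (by exact_mod_cast hγ.le)) le_rfl)
  have hj : φ j ≠ ⊤ := by
    intro hj
    obtain ⟨x, hx⟩ := hp
    obtain ⟨b, hb⟩ := EReal.exists_coe_eq hx (hbot x)
    have := hreal x b hb.le
    rw [hj, EReal.coe_mul_top_of_pos hγ, EReal.top_add_coe, top_le_iff] at this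
    exact EReal.coe_ne_top _ this
  obtain ⟨a, ha⟩ := EReal.exists_coe_eq hj (hbot j)
  refine mem_esubdiff_iff.mpr ⟨a, ha, fun y => ?_⟩
  rcases eq_or_ne (φ y) ⊤ with hy | hy
  · simp [hy]
  obtain ⟨b, hb⟩ := EReal.exists_coe_eq hy (hbot y)
  have key : ∀ t : ℝ, 0 < t → t ≤ 1 → γ * (a - b) ≤ ⟪j - w, y - j⟫ + t * (‖y - j‖ ^ 2 / 2) := by
    intro t ht ht1
    have h1 := hreal _ _ (hφ.le_of_convex_comb ha hb (sub_nonneg.mpr ht1) ht.le (by ring))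
    rw [ha, ← EReal.coe_mul, ← EReal.coe_add, EReal.coe_le_coe_iff,
      show (1 - t) • j + t • y - w = (j - w) + t • (y - j) by module,
      norm_add_sq_real, inner_smul_right, norm_smul, mul_pow, Real.norm_of_nonneg ht.le] at h1
    have h2 : t * (γ * (a - b)) ≤ t * (⟪j - w, y - j⟫ + t * (‖y - j‖ ^ 2 / 2)) := by linarith
    exact le_of_mul_le_mul_left h2 ht
  have hlim : γ * (a - b) ≤ ⟪j - w, y - j⟫ := by
    have h1 : Tendsto (fun t : ℝ => ⟪j - w, y - j⟫ + t * (‖y - j‖ ^ 2 / 2)) (𝓝[>] 0)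
        (𝓝 (⟪j - w, y - j⟫ + 0 * (‖y - j‖ ^ 2 / 2))) :=
      ((continuous_const.add (continuous_id.mul continuous_const)).tendsto 0).mono_left
        nhdsWithin_le_nhds
    rw [zero_mul, add_zero] at h1
    refine ge_of_tendsto h1 ?_
    filter_upwards [Ioc_mem_nhdsGT (zero_lt_one (α := ℝ))] with t ht using key t ht.1 ht.2
  rw [hb, EReal.coe_le_coe_iff, inner_smul_left, RCLike.conj_to_real,
    ← neg_sub j w, inner_neg_left]
  have h3 : a - b ≤ γ⁻¹ * ⟪j - w, y - j⟫ := by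
    rwa [← div_eq_inv_mul, le_div_iff₀ hγ, mul_comm]
  linarith

/-- Weak-weak closedness of the graph of a subdifferential, and the comparison of the limit of
the duality products with the duality product of the limits. -/
theorem HasAffineMinorants.subdiff_weak_limit {φ : E → EReal} (hφ : HasAffineMinorants φ)
    (hbot : ∀ x, φ x ≠ ⊥) {U : Ultrafilter ℕ} {x u : ℕ → E} {a b : E} {κ : ℝ}
    (hxu : ∀ n, u n ∈ esubdiff φ (x n)) (hx : UWConv U x a) (hu : UWConv U u b)
    (hκ : Tendsto (fun n => ⟪u n, x n⟫) U (𝓝 κ)) :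
    ⟪b, a⟫ ≤ κ ∧ (κ ≤ ⟪b, a⟫ → b ∈ esubdiff φ a) := by
  have key : ∀ (y : E) (s : ℝ), φ y = s → φ a ≤ ((s - ⟪b, y⟫ + κ : ℝ) : EReal) := by
    intro y s hy
    by_contra! hlt
    obtain ⟨c, α, h1, h2⟩ := hφ _ _ hlt
    have h3 : ∀ n, ⟪c, x n⟫ + α + (⟪u n, y⟫ - ⟪u n, x n⟫) ≤ s := fun n => by
      obtain ⟨d, hd, h4⟩ := mem_esubdiff_iff.mp (hxu n)
      have h5 := h2 (x n)
      have h6 := h4 y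
      rw [hd, EReal.coe_le_coe_iff] at h5
      rw [hy, EReal.coe_le_coe_iff, inner_sub_right] at h6
      linarith
    have h7 : Tendsto (fun n => ⟪c, x n⟫ + α + (⟪u n, y⟫ - ⟪u n, x n⟫)) U
        (𝓝 (⟪c, a⟫ + α + (⟪b, y⟫ - κ))) := by
      have := hx c
      simp_rw [real_inner_comm c] at this
      exact (this.add_const α).add ((hu y).sub hκ)
    have h8 := le_of_tendsto h7 (Eventually.of_forall h3)
    linarith
  obtain ⟨d, hd, -⟩ := mem_esubdiff_iff.mp (hxu 0)
  obtain ⟨e, he⟩ := EReal.exists_coe_eq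
    (ne_of_lt ((key _ _ hd).trans_lt (EReal.coe_lt_top _))) (hbot a)
  have h1 := key a e he
  rw [he, EReal.coe_le_coe_iff] at h1
  refine ⟨by linarith, fun hle => mem_esubdiff_iff.mpr ⟨e, he, fun y => ?_⟩⟩
  rcases eq_or_ne (φ y) ⊤ with hy | hy
  · simp [hy]
  obtain ⟨s, hs⟩ := EReal.exists_coe_eq hy (hbot y)
  have h2 := key y s hs
  rw [he, EReal.coe_le_coe_iff] at h2
  rw [hs, EReal.coe_le_coe_iff, inner_sub_right]
  linarith

theorem gradient_mem_esubdiff [CompleteSpace E] {h : E → ℝ}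
    (hh : ProperConvLsc fun x => (h x : EReal)) {x d : E} (hd : HasGradientAt h d x) :
    d ∈ esubdiff (fun x => (h x : EReal)) x := by
  refine mem_esubdiff_iff.mpr ⟨h x, rfl, fun y => ?_⟩
  rw [EReal.coe_le_coe_iff]
  have hconv : ConvexOn ℝ Set.univ h := ⟨convex_univ, fun a _ b _ s t hs ht hst => by
    have := hh.2.2.1 a b s t hs ht hst
    beta_reduce at this
    exact_mod_cast this⟩
  have hline : ConvexOn ℝ Set.univ (fun t : ℝ => h (AffineMap.lineMap x y t)) :=
    hconv.comp_affineMap (AffineMap.lineMap x y)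
  have hderiv : HasDerivAt (fun t : ℝ => h (AffineMap.lineMap x y t)) ⟪d, y - x⟫ 0 := by
    have h1 : HasFDerivAt h (InnerProductSpace.toDual ℝ E d) (AffineMap.lineMap x y (0 : ℝ)) := by
      simpa using hd.hasFDerivAt
    exact h1.comp_hasDerivAt (0 : ℝ) AffineMap.hasDerivAt_lineMap
  have := hline.le_slope_of_hasDerivAt (Set.mem_univ 0) (Set.mem_univ 1) zero_lt_one hderiv
  simp [slope_def_field] at this
  linarith

theorem eq_gradient_of_mem_esubdiff [CompleteSpace E] {h : E → ℝ} {x d u : E}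
    (hd : HasGradientAt h d x) (hu : u ∈ esubdiff (fun x => (h x : EReal)) x) : u = d := by
  have hmin : IsLocalMin (fun y => h y - ⟪u, y⟫) x := by
    refine Filter.Eventually.of_forall fun y => ?_
    have h1 : ((h x + ⟪u, y - x⟫ : ℝ) : EReal) ≤ h y := hu.2.2 y
    rw [EReal.coe_le_coe_iff, inner_sub_right] at h1
    linarith
  have h2 := hmin.hasFDerivAt_eq_zero
    (hd.hasFDerivAt.sub ((InnerProductSpace.toDual ℝ E u).hasFDerivAt))
  rw [← map_sub, map_eq_zero_iff _ (InnerProductSpace.toDual ℝ E).injective] at h2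
  exact (sub_eq_zero.mp h2).symm

end Convex

section Duality

theorem EReal.coe_finset_sum {ι : Type*} (s : Finset ι) (a : ι → ℝ) :
    ((∑ i ∈ s, a i : ℝ) : EReal) = ∑ i ∈ s, (a i : EReal) := by
  classical
  induction s using Finset.induction_on with
  | empty => simp
  | insert i s hi ih => rw [Finset.sum_insert hi, Finset.sum_insert hi, EReal.coe_add, ih]

theorem le_einfConv_comp {F X Y : Type*}
    [NormedAddCommGroup F] [InnerProductSpace ℝ F] [CompleteSpace F]
    [NormedAddCommGroup X] [InnerProductSpace ℝ X] [CompleteSpace X]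
    [NormedAddCommGroup Y] [InnerProductSpace ℝ Y] [CompleteSpace Y]
    {g : X → EReal} {l : Y → EReal} {K : F →L[ℝ] X} {M : F →L[ℝ] Y} {a b v : F} {p : X} {q : Y}
    {A B : ℝ} (hA : g (K a) = A) (hB : l (M b) = B)
    (hp : p ∈ esubdiff g (K a)) (hq : q ∈ esubdiff l (M b))
    (hpv : ContinuousLinearMap.adjoint K p = v) (hqv : ContinuousLinearMap.adjoint M q = v)
    (w : F) : ((A + B + ⟪v, w - (a + b)⟫ : ℝ) : EReal) ≤
      einfConv (fun w => g (K w)) (fun w => l (M w)) w := by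
  refine le_iInf fun s => ?_
  have h1 := hp.2.2 (K s)
  have h2 := hq.2.2 (M (w - s))
  rw [hA, ← EReal.coe_add, ← map_sub, ← ContinuousLinearMap.adjoint_inner_left, hpv] at h1
  rw [hB, ← EReal.coe_add, ← map_sub, ← ContinuousLinearMap.adjoint_inner_left, hqv] at h2
  refine le_trans (le_of_eq ?_) (add_le_add h1 h2)
  rw [← EReal.coe_add]
  congr 1
  simp only [inner_sub_right, inner_add_right]
  ring

variable {m : ℕ}
    {H : Type*} [NormedAddCommGroup H] [InnerProductSpace ℝ H] [CompleteSpace H]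
    {G : Fin m → Type*} [∀ i, NormedAddCommGroup (G i)] [∀ i, InnerProductSpace ℝ (G i)]
    [∀ i, CompleteSpace (G i)]
    {X : Fin m → Type*} [∀ i, NormedAddCommGroup (X i)] [∀ i, InnerProductSpace ℝ (X i)]
    [∀ i, CompleteSpace (X i)]
    {Y : Fin m → Type*} [∀ i, NormedAddCommGroup (Y i)] [∀ i, InnerProductSpace ℝ (Y i)]
    [∀ i, CompleteSpace (Y i)]

theorem primal_dual_optimal {z : H} {f : H → EReal} {h : H → ℝ} {h' : H → H} {r : ∀ i, G i}
    {g : ∀ i, X i → EReal} {l : ∀ i, Y i → EReal}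
    {L : ∀ i, H →L[ℝ] G i} {K : ∀ i, G i →L[ℝ] X i} {M : ∀ i, G i →L[ℝ] Y i}
    {xb : H} {pb : ∀ i, X i} {qb : ∀ i, Y i} {zb yb vb : ∀ i, G i}
    (hf : z - (h' xb + ∑ i, ContinuousLinearMap.adjoint (L i) (vb i)) ∈ esubdiff f xb)
    (hh : h' xb ∈ esubdiff (fun x => (h x : EReal)) xb)
    (hg : ∀ i, pb i ∈ esubdiff (g i) (K i (zb i)))
    (hl : ∀ i, qb i ∈ esubdiff (l i) (M i (yb i)))
    (hpv : ∀ i, ContinuousLinearMap.adjoint (K i) (pb i) = vb i)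
    (hqv : ∀ i, ContinuousLinearMap.adjoint (M i) (qb i) = vb i)
    (hr : ∀ i, L i xb - r i = zb i + yb i) :
    (∀ x' : H, Pval z f h g l r L K M xb ≤ Pval z f h g l r L K M x') ∧
      (∀ (p' : ∀ i, X i) (q' : ∀ i, Y i),
        (∀ i, ContinuousLinearMap.adjoint (K i) (p' i) =
          ContinuousLinearMap.adjoint (M i) (q' i)) →
        Dval z f h g l r L K M p' q' ≤ Dval z f h g l r L K M pb qb) := by
  obtain ⟨F, hF, -⟩ := mem_esubdiff_iff.mp hf
  choose A hA _ using fun i => mem_esubdiff_iff.mp (hg i)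
  choose B hB _ using fun i => mem_esubdiff_iff.mp (hl i)
  have hsum : ∀ (w : ∀ i, G i) (d : H),
      ⟪∑ i, ContinuousLinearMap.adjoint (L i) (w i), d⟫ = ∑ i, ⟪w i, L i d⟫ := fun w d => by
    simp_rw [sum_inner, ContinuousLinearMap.adjoint_inner_left]
  let P : ℝ := F + (∑ i, (A i + B i)) + (h xb - ⟪xb, z⟫)
  have hP1 : Pval z f h g l r L K M xb ≤ P := by
    unfold Pval
    simp only [P, EReal.coe_add, EReal.coe_finset_sum, hF]
    refine add_le_add_left (add_le_add_right (Finset.sum_le_sum fun i _ => ?_) _) _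
    refine (iInf_le _ (zb i)).trans (le_of_eq ?_)
    simp [hr i, hA i, hB i]
  have hP2 : ∀ x', (P : EReal) ≤ Pval z f h g l r L K M x' := by
    intro x'
    have h1 := hf.2.2 x'
    have h2 : ∀ i, _ := fun i =>
      le_einfConv_comp (hA i) (hB i) (hg i) (hl i) (hpv i) (hqv i) (L i x' - r i)
    have h3 : ((h xb + ⟪h' xb, x' - xb⟫ : ℝ) : EReal) ≤ h x' := hh.2.2 x'
    rw [hF, ← EReal.coe_add] at h1
    rw [EReal.coe_le_coe_iff] at h3
    have h4 := Finset.sum_le_sum fun i (_ : i ∈ Finset.univ) => h2 i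
    rw [← EReal.coe_finset_sum] at h4
    have h5 : ((h xb + ⟪h' xb, x' - xb⟫ - ⟪x', z⟫ : ℝ) : EReal) ≤ ((h x' - ⟪x', z⟫ : ℝ) : EReal) := by
      rw [EReal.coe_le_coe_iff]; linarith
    refine le_trans (le_of_eq ?_) (add_le_add (add_le_add h1 h4) h5)
    rw [← EReal.coe_add, ← EReal.coe_add]
    congr 1
    have h6 : ∀ i, L i x' - r i - (zb i + yb i) = L i (x' - xb) := fun i => by
      rw [← hr, map_sub]; abel
    simp only [P, h6, inner_sub_left, inner_add_left, hsum, Finset.sum_add_distrib]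
    rw [inner_sub_right z, real_inner_comm x' z, real_inner_comm xb z]
    ring
  have hD1 : ∀ (p' : ∀ i, X i) (q' : ∀ i, Y i),
      (∀ i, ContinuousLinearMap.adjoint (K i) (p' i) =
        ContinuousLinearMap.adjoint (M i) (q' i)) → Dval z f h g l r L K M p' q' ≤ P := by
    intro p' q' hpq
    have h1 : ((⟪z - ∑ i, ContinuousLinearMap.adjoint (L i)
        (ContinuousLinearMap.adjoint (K i) (p' i)), xb⟫ - F - h xb : ℝ) : EReal) ≤
        einfConv (econj f) (econj (fun x => (h x : EReal))) (z - ∑ i,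
          ContinuousLinearMap.adjoint (L i) (ContinuousLinearMap.adjoint (K i) (p' i))) := by
      refine le_iInf fun s => ?_
      refine le_trans (le_of_eq ?_) (add_le_add (le_econj hF s)
        (le_econj (φ := fun x => (h x : EReal)) (x := xb) rfl _))
      rw [← EReal.coe_add, inner_sub_left _ s]
      congr 1
      ring
    have h2 : ∀ i, ((⟪p' i, K i (zb i)⟫ - A i + (⟪q' i, M i (yb i)⟫ - B i) +
        ⟪p' i, K i (r i)⟫ : ℝ) : EReal) ≤
        econj (g i) (p' i) + econj (l i) (q' i) + ((⟪p' i, K i (r i)⟫ : ℝ) : EReal) := fun i => by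
      rw [EReal.coe_add, EReal.coe_add]
      exact add_le_add (add_le_add (le_econj (hA i) _) (le_econj (hB i) _)) le_rfl
    have h3 := Finset.sum_le_sum fun i (_ : i ∈ Finset.univ) => h2 i
    rw [← EReal.coe_finset_sum] at h3
    refine (EReal.sub_le_sub (EReal.neg_le_neg_iff.mpr h1) h3).trans (le_of_eq ?_)
    rw [← EReal.coe_neg, ← EReal.coe_sub]
    congr 1
    have h4 : ∀ i, ⟪p' i, K i (zb i)⟫ - A i + (⟪q' i, M i (yb i)⟫ - B i) + ⟪p' i, K i (r i)⟫ =
        ⟪ContinuousLinearMap.adjoint (K i) (p' i), L i xb⟫ - (A i + B i) := fun i => by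
      rw [← ContinuousLinearMap.adjoint_inner_left, ← ContinuousLinearMap.adjoint_inner_left,
        ← ContinuousLinearMap.adjoint_inner_left, ← hpq, show L i xb = zb i + yb i + r i by
          rw [← hr]; abel, inner_add_right, inner_add_right]
      ring
    simp only [h4, inner_sub_left, hsum, Finset.sum_sub_distrib, P]
    rw [real_inner_comm z xb]
    ring
  have hD2 : (P : EReal) ≤ Dval z f h g l r L K M pb qb := by
    have h1 : einfConv (econj f) (econj (fun x => (h x : EReal))) (z - ∑ i,
          ContinuousLinearMap.adjoint (L i) (ContinuousLinearMap.adjoint (K i) (pb i))) ≤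
        ((⟪z - (h' xb + ∑ i, ContinuousLinearMap.adjoint (L i) (vb i)), xb⟫ - F +
          (⟪h' xb, xb⟫ - h xb) : ℝ) : EReal) := by
      refine (iInf_le _ (z - (h' xb + ∑ i, ContinuousLinearMap.adjoint (L i) (vb i)))).trans ?_
      rw [EReal.coe_add, econj_eq_of_mem_esubdiff hF hf]
      refine add_le_add le_rfl (le_of_eq ?_)
      rw [← econj_eq_of_mem_esubdiff (φ := fun x => (h x : EReal)) rfl hh]
      simp only [hpv]
      congr 1
      abel
    have h2 : ∀ i, econj (g i) (pb i) + econj (l i) (qb i) + ((⟪pb i, K i (r i)⟫ : ℝ) : EReal) =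
        ((⟪vb i, L i xb⟫ - (A i + B i) : ℝ) : EReal) := fun i => by
      rw [econj_eq_of_mem_esubdiff (hA i) (hg i), econj_eq_of_mem_esubdiff (hB i) (hl i),
        ← EReal.coe_add, ← EReal.coe_add, ← ContinuousLinearMap.adjoint_inner_left,
        ← ContinuousLinearMap.adjoint_inner_left, ← ContinuousLinearMap.adjoint_inner_left,
        hpv, hqv, show L i xb = zb i + yb i + r i by rw [← hr]; abel, inner_add_right,
        inner_add_right]
      congr 1
      ring
    unfold Dval
    rw [Finset.sum_congr rfl fun i _ => h2 i, ← EReal.coe_finset_sum]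
    refine le_trans (le_of_eq ?_) (EReal.sub_le_sub (EReal.neg_le_neg_iff.mpr h1) le_rfl)
    rw [← EReal.coe_neg, ← EReal.coe_sub]
    congr 1
    simp only [P, inner_sub_left, inner_add_left, hsum, Finset.sum_sub_distrib]
    rw [real_inner_comm z xb]
    ring
  exact ⟨fun x' => hP1.trans (hP2 x'), fun p' q' hpq => (hD1 p' q' hpq).trans hD2⟩

end Duality

theorem WConv.clm {E F : Type*} [NormedAddCommGroup E] [InnerProductSpace ℝ E] [CompleteSpace E]
    [NormedAddCommGroup F] [InnerProductSpace ℝ F] [CompleteSpace F] {u : ℕ → E} {a : E}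
    (hu : WConv u a) (T : E →L[ℝ] F) : WConv (fun n => T (u n)) (T a) := fun w => by
  simpa only [ContinuousLinearMap.adjoint_inner_right] using hu (ContinuousLinearMap.adjoint T w)

theorem UWConv.clm {E F : Type*} [NormedAddCommGroup E] [InnerProductSpace ℝ E] [CompleteSpace E]
    [NormedAddCommGroup F] [InnerProductSpace ℝ F] [CompleteSpace F] {U : Ultrafilter ℕ}
    {u : ℕ → E} {a : E} (hu : UWConv U u a) (T : E →L[ℝ] F) :
    UWConv U (fun n => T (u n)) (T a) := fun w => by
  simpa only [ContinuousLinearMap.adjoint_inner_right] using hu (ContinuousLinearMap.adjoint T w)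

section ProductSpace

/-- The Hilbert sum of `X`, `Y` and three copies of `G`. -/
abbrev PDBlock (X Y G : Type*) : Type _ :=
  WithLp 2 (X × WithLp 2 (Y × WithLp 2 (G × WithLp 2 (G × G))))

/-- The Hilbert sum of `H` and of the blocks `PDBlock (X i) (Y i) (G i)`. -/
def PDSpace {m : ℕ} (H : Type*) (X Y G : Fin m → Type*) : Type _ :=
  WithLp 2 (H × PiLp 2 fun i => PDBlock (X i) (Y i) (G i))

variable {m : ℕ}
    {H : Type*} [NormedAddCommGroup H] [InnerProductSpace ℝ H]
    {G : Fin m → Type*} [∀ i, NormedAddCommGroup (G i)] [∀ i, InnerProductSpace ℝ (G i)]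
    {X : Fin m → Type*} [∀ i, NormedAddCommGroup (X i)] [∀ i, InnerProductSpace ℝ (X i)]
    {Y : Fin m → Type*} [∀ i, NormedAddCommGroup (Y i)] [∀ i, InnerProductSpace ℝ (Y i)]

instance : NormedAddCommGroup (PDSpace H X Y G) :=
  inferInstanceAs (NormedAddCommGroup (WithLp 2 (H × PiLp 2 fun i => PDBlock (X i) (Y i) (G i))))

instance : InnerProductSpace ℝ (PDSpace H X Y G) :=
  inferInstanceAs (InnerProductSpace ℝ (WithLp 2 (H × PiLp 2 fun i => PDBlock (X i) (Y i) (G i))))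

instance [CompleteSpace H] [∀ i, CompleteSpace (G i)] [∀ i, CompleteSpace (X i)]
    [∀ i, CompleteSpace (Y i)] : CompleteSpace (PDSpace H X Y G) :=
  inferInstanceAs (CompleteSpace (WithLp 2 (H × PiLp 2 fun i => PDBlock (X i) (Y i) (G i))))

namespace PDSpace

/-- The element of `PDSpace` with the given components. -/
def mk (x : H) (p : ∀ i, X i) (q : ∀ i, Y i) (z y v : ∀ i, G i) : PDSpace H X Y G :=
  WithLp.toLp 2 (x, WithLp.toLp 2 fun i => WithLp.toLp 2 (p i, WithLp.toLp 2 (q i,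
    WithLp.toLp 2 (z i, WithLp.toLp 2 (y i, v i)))))

/-- The `H` component. -/
def projX : PDSpace H X Y G →L[ℝ] H := WithLp.fstL 2 ℝ _ _

/-- The `i`-th block. -/
def block (i : Fin m) : PDSpace H X Y G →L[ℝ] PDBlock (X i) (Y i) (G i) :=
  (PiLp.proj 2 (fun i => PDBlock (X i) (Y i) (G i)) i).comp (WithLp.sndL 2 ℝ _ _)

/-- The `X i` component. -/
def projP (i : Fin m) : PDSpace H X Y G →L[ℝ] X i := (WithLp.fstL 2 ℝ _ _).comp (block i)

/-- The `Y i` component. -/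
def projQ (i : Fin m) : PDSpace H X Y G →L[ℝ] Y i :=
  (WithLp.fstL 2 ℝ _ _).comp ((WithLp.sndL 2 ℝ _ _).comp (block i))

/-- The first `G i` component. -/
def projZ (i : Fin m) : PDSpace H X Y G →L[ℝ] G i :=
  (WithLp.fstL 2 ℝ _ _).comp ((WithLp.sndL 2 ℝ _ _).comp ((WithLp.sndL 2 ℝ _ _).comp (block i)))

/-- The second `G i` component. -/
def projY (i : Fin m) : PDSpace H X Y G →L[ℝ] G i :=
  (WithLp.fstL 2 ℝ _ _).comp ((WithLp.sndL 2 ℝ _ _).comp ((WithLp.sndL 2 ℝ _ _).comp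
    ((WithLp.sndL 2 ℝ _ _).comp (block i))))

/-- The third `G i` component. -/
def projV (i : Fin m) : PDSpace H X Y G →L[ℝ] G i :=
  (WithLp.sndL 2 ℝ _ _).comp ((WithLp.sndL 2 ℝ _ _).comp ((WithLp.sndL 2 ℝ _ _).comp
    ((WithLp.sndL 2 ℝ _ _).comp (block i))))

section mk

variable (x : H) (p : ∀ i, X i) (q : ∀ i, Y i) (z y v : ∀ i, G i) (i : Fin m)

@[simp] theorem projX_mk : projX (mk x p q z y v) = x := rfl
@[simp] theorem projP_mk : projP i (mk x p q z y v) = p i := rfl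
@[simp] theorem projQ_mk : projQ i (mk x p q z y v) = q i := rfl
@[simp] theorem projZ_mk : projZ i (mk x p q z y v) = z i := rfl
@[simp] theorem projY_mk : projY i (mk x p q z y v) = y i := rfl
@[simp] theorem projV_mk : projV i (mk x p q z y v) = v i := rfl

end mk

theorem inner_eq (w w' : PDSpace H X Y G) : ⟪w, w'⟫ = ⟪projX w, projX w'⟫ +
    ∑ i, (⟪projP i w, projP i w'⟫ + ⟪projQ i w, projQ i w'⟫ + ⟪projZ i w, projZ i w'⟫ +
      ⟪projY i w, projY i w'⟫ + ⟪projV i w, projV i w'⟫) := by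
  refine (WithLp.prod_inner_apply (𝕜 := ℝ) (E := H)
    (F := PiLp 2 fun i => PDBlock (X i) (Y i) (G i)) w w').trans ?_
  rw [PiLp.inner_apply]
  simp only [WithLp.prod_inner_apply]
  congr 1
  refine Finset.sum_congr rfl fun i _ => ?_
  simp only [add_assoc]
  rfl

theorem norm_sq_eq (w : PDSpace H X Y G) : ‖w‖ ^ 2 = ‖projX w‖ ^ 2 +
    ∑ i, (‖projP i w‖ ^ 2 + ‖projQ i w‖ ^ 2 + ‖projZ i w‖ ^ 2 + ‖projY i w‖ ^ 2 +
      ‖projV i w‖ ^ 2) := by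
  simp only [← real_inner_self_eq_norm_sq]
  exact inner_eq w w

theorem norm_le (w : PDSpace H X Y G) : ‖w‖ ≤ ‖projX w‖ +
    ∑ i, (‖projP i w‖ + ‖projQ i w‖ + ‖projZ i w‖ + ‖projY i w‖ + ‖projV i w‖) := by
  refine le_of_sq_le_sq ?_ (by positivity)
  have h1 : ∀ a b : ℝ, 0 ≤ a → 0 ≤ b → a ^ 2 + b ^ 2 ≤ (a + b) ^ 2 := fun a b ha hb => by
    nlinarith [mul_nonneg ha hb]
  rw [norm_sq_eq]
  refine le_trans (add_le_add le_rfl ?_) (h1 _ _ (norm_nonneg _) (by positivity))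
  refine le_trans (Finset.sum_le_sum fun i _ => ?_)
    (Finset.sum_sq_le_sq_sum_of_nonneg (fun i _ => by positivity))
  calc _ ≤ (‖projP i w‖ + ‖projQ i w‖) ^ 2 + ‖projZ i w‖ ^ 2 + ‖projY i w‖ ^ 2 +
        ‖projV i w‖ ^ 2 := by gcongr; exact h1 _ _ (by positivity) (by positivity)
    _ ≤ (‖projP i w‖ + ‖projQ i w‖ + ‖projZ i w‖) ^ 2 + ‖projY i w‖ ^ 2 + ‖projV i w‖ ^ 2 := by
        gcongr; exact h1 _ _ (by positivity) (by positivity)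
    _ ≤ (‖projP i w‖ + ‖projQ i w‖ + ‖projZ i w‖ + ‖projY i w‖) ^ 2 + ‖projV i w‖ ^ 2 := by
        gcongr; exact h1 _ _ (by positivity) (by positivity)
    _ ≤ _ := h1 _ _ (by positivity) (by positivity)

theorem summable_norm {w : ℕ → PDSpace H X Y G} (hx : Summable fun n => ‖projX (w n)‖)
    (hp : ∀ i, Summable fun n => ‖projP i (w n)‖) (hq : ∀ i, Summable fun n => ‖projQ i (w n)‖)
    (hz : ∀ i, Summable fun n => ‖projZ i (w n)‖) (hy : ∀ i, Summable fun n => ‖projY i (w n)‖)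
    (hv : ∀ i, Summable fun n => ‖projV i (w n)‖) : Summable fun n => ‖w n‖ :=
  Summable.of_nonneg_of_le (fun _ => norm_nonneg _) (fun n => norm_le (w n))
    (hx.add (summable_sum fun i _ => ((((hp i).add (hq i)).add (hz i)).add (hy i)).add (hv i)))

theorem ext_proj {w w' : PDSpace H X Y G} (hx : projX w = projX w')
    (hp : ∀ i, projP i w = projP i w') (hq : ∀ i, projQ i w = projQ i w')
    (hz : ∀ i, projZ i w = projZ i w') (hy : ∀ i, projY i w = projY i w')
    (hv : ∀ i, projV i w = projV i w') : w = w' := by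
  have := norm_le (w - w')
  simp only [map_sub, hx, hp, hq, hz, hy, hv, sub_self, norm_zero, add_zero,
    Finset.sum_const_zero] at this
  exact sub_eq_zero.mp (norm_le_zero_iff.mp this)

theorem norm_projX_le (w : PDSpace H X Y G) : ‖projX w‖ ≤ ‖w‖ := by
  refine le_of_sq_le_sq ?_ (norm_nonneg _)
  rw [norm_sq_eq w]
  exact le_add_of_nonneg_right (by positivity)

end PDSpace

end ProductSpace

section UltrafilterWeak

variable {E : Type*} [NormedAddCommGroup E] [InnerProductSpace ℝ E] {U : Ultrafilter ℕ}
  {u v : ℕ → E} {a b : E}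

theorem UWConv.of_tendsto (hu : Tendsto u U (𝓝 a)) : UWConv U u a := fun _ =>
  hu.inner tendsto_const_nhds

theorem UWConv.add (hu : UWConv U u a) (hv : UWConv U v b) :
    UWConv U (fun n => u n + v n) (a + b) := fun w => by
  simpa only [inner_add_left] using (hu w).add (hv w)

theorem UWConv.sub (hu : UWConv U u a) (hv : UWConv U v b) :
    UWConv U (fun n => u n - v n) (a - b) := fun w => by
  simpa only [inner_sub_left] using (hu w).sub (hv w)

theorem UWConv.sum {ι : Type*} {s : Finset ι} {u : ι → ℕ → E} {a : ι → E}
    (hu : ∀ i, UWConv U (u i) (a i)) : UWConv U (fun n => ∑ i ∈ s, u i n) (∑ i ∈ s, a i) :=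
  fun w => by
    simpa only [sum_inner] using tendsto_finsetSum s fun i _ => hu i w

theorem UWConv.unique (hu : UWConv U u a) (hv : UWConv U u b) : a = b :=
  ext_inner_right ℝ fun w => tendsto_nhds_unique (hu w) (hv w)

theorem exists_tendsto_inner_of_isBigO (hu : u =O[(U : Filter ℕ)] fun _ => (1 : ℝ))
    (hv : v =O[(U : Filter ℕ)] fun _ => (1 : ℝ)) :
    ∃ κ : ℝ, Tendsto (fun n => ⟪u n, v n⟫) U (𝓝 κ) := by
  obtain ⟨C, hC⟩ := hu.bound
  obtain ⟨D, hD⟩ := hv.bound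
  obtain ⟨κ, hκ⟩ := exists_uWConv U (fun n => ⟪u n, v n⟫) (C := C * D) (by
    filter_upwards [hC, hD] with n h1 h2
    simp only [norm_one, mul_one] at h1 h2
    exact (norm_inner_le_norm _ _).trans
      (mul_le_mul h1 h2 (norm_nonneg _) ((norm_nonneg _).trans h1)))
  exact ⟨κ, by simpa using hκ 1⟩

theorem isBigO_one_clm {F : Type*} [NormedAddCommGroup F] [InnerProductSpace ℝ F]
    (hu : u =O[(U : Filter ℕ)] fun _ => (1 : ℝ)) (T : E →L[ℝ] F) :
    (fun n => T (u n)) =O[(U : Filter ℕ)] fun _ => (1 : ℝ) :=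
  (T.isBigO_comp _ _).trans hu

end UltrafilterWeak

theorem norm_clm_apply_sq_le {E F : Type*} [NormedAddCommGroup E] [NormedSpace ℝ E]
    [NormedAddCommGroup F] [NormedSpace ℝ F] (T : E →L[ℝ] F) {s : ℝ} (hT : ‖T‖ ^ 2 ≤ s) (a : E) :
    ‖T a‖ ^ 2 ≤ s * ‖a‖ ^ 2 := by
  calc ‖T a‖ ^ 2 ≤ (‖T‖ * ‖a‖) ^ 2 := by gcongr; exact T.le_opNorm a
    _ = ‖T‖ ^ 2 * ‖a‖ ^ 2 := mul_pow _ _ _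
    _ ≤ _ := by gcongr

/-- The explicit solution of the linear system satisfied by the `z` and `y` components of the
resolvent. -/
theorem coupled_resolvent {E : Type*} [AddCommGroup E] [Module ℝ E] {γ : ℝ} {a b z y : E}
    (hz : z = ((1 + γ ^ 2) / (1 + 2 * γ ^ 2)) • (a - (γ ^ 2 / (1 + γ ^ 2)) • b))
    (hy : y = (1 / (1 + γ ^ 2)) • (b - γ ^ 2 • z)) :
    a - z = γ ^ 2 • (z + y) ∧ b - y = γ ^ 2 • (z + y) := by
  have h1 : (1 + γ ^ 2) ≠ 0 := by positivity
  have h2 : (1 + 2 * γ ^ 2) ≠ 0 := by positivity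
  subst hy
  subst hz
  constructor
  · match_scalars
    all_goals
      field_simp
      ring
  · match_scalars
    all_goals
      field_simp
      ring

theorem summable_norm_of_eq_add_smul {E : Type*} [NormedAddCommGroup E] [NormedSpace ℝ E]
    {e e₀ e₁ e₂ : ℕ → E} {c d : ℕ → ℝ} {C D : ℝ} (hc : ∀ n, |c n| ≤ C) (hd : ∀ n, |d n| ≤ D)
    (h₀ : Summable fun n => ‖e₀ n‖) (h₁ : Summable fun n => ‖e₁ n‖)
    (h₂ : Summable fun n => ‖e₂ n‖) (he : ∀ n, e n = e₀ n + c n • e₁ n + d n • e₂ n) :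
    Summable fun n => ‖e n‖ := by
  refine Summable.of_nonneg_of_le (fun n => norm_nonneg _) (fun n => ?_)
    ((h₀.add (h₁.mul_left C)).add (h₂.mul_left D))
  rw [he]
  refine (norm_add₃_le).trans ?_
  rw [norm_smul, norm_smul, Real.norm_eq_abs, Real.norm_eq_abs]
  gcongr
  · exact hc n
  · exact hd n

section PrimalDual

variable {m : ℕ}
    {H : Type*} [NormedAddCommGroup H] [InnerProductSpace ℝ H] [CompleteSpace H]
    {G : Fin m → Type*} [∀ i, NormedAddCommGroup (G i)] [∀ i, InnerProductSpace ℝ (G i)]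
    [∀ i, CompleteSpace (G i)]
    {X : Fin m → Type*} [∀ i, NormedAddCommGroup (X i)] [∀ i, InnerProductSpace ℝ (X i)]
    [∀ i, CompleteSpace (X i)]
    {Y : Fin m → Type*} [∀ i, NormedAddCommGroup (Y i)] [∀ i, InnerProductSpace ℝ (Y i)]
    [∀ i, CompleteSpace (Y i)]

open PDSpace ContinuousLinearMap

/-- The single-valued part of the primal-dual inclusion: the gradient of `h` plus the skew
operator built from `L`, `K` and `M`. -/
def pdForward (h' : H → H) (L : ∀ i, H →L[ℝ] G i) (K : ∀ i, G i →L[ℝ] X i)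
    (M : ∀ i, G i →L[ℝ] Y i) (w : PDSpace H X Y G) : PDSpace H X Y G :=
  mk (h' (projX w) + ∑ i, adjoint (L i) (projV i w)) (fun i => -K i (projZ i w))
    (fun i => -M i (projY i w)) (fun i => adjoint (K i) (projP i w))
    (fun i => adjoint (M i) (projQ i w)) (fun i => -L i (projX w))

theorem norm_sum_adjoint_sq_le (L : ∀ i, H →L[ℝ] G i) {s : ℝ} (hs : ∑ i, ‖L i‖ ^ 2 ≤ s)
    (v : ∀ i, G i) : ‖∑ i, adjoint (L i) (v i)‖ ^ 2 ≤ s * ∑ i, ‖v i‖ ^ 2 := by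
  calc ‖∑ i, adjoint (L i) (v i)‖ ^ 2 ≤ (∑ i, ‖L i‖ * ‖v i‖) ^ 2 := by
        gcongr
        refine (norm_sum_le _ _).trans (Finset.sum_le_sum fun i _ => ?_)
        have := (adjoint (L i)).le_opNorm (v i)
        rwa [LinearIsometryEquiv.norm_map] at this
    _ ≤ (∑ i, ‖L i‖ ^ 2) * ∑ i, ‖v i‖ ^ 2 := Finset.sum_mul_sq_le_sq_mul_sq _ _ _
    _ ≤ _ := by gcongr

theorem norm_pdForward_zero_le (L : ∀ i, H →L[ℝ] G i) (K : ∀ i, G i →L[ℝ] X i)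
    (M : ∀ i, G i →L[ℝ] Y i) {s : ℝ} (hL : ∑ i, ‖L i‖ ^ 2 ≤ s) (hK : ∀ i, ‖K i‖ ^ 2 ≤ s)
    (hM : ∀ i, ‖M i‖ ^ 2 ≤ s) (w : PDSpace H X Y G) :
    ‖pdForward (fun _ => 0) L K M w‖ ≤ √s * ‖w‖ := by
  have hs : 0 ≤ s := le_trans (by positivity) hL
  refine le_of_sq_le_sq ?_ (by positivity)
  rw [mul_pow, Real.sq_sqrt hs, norm_sq_eq, norm_sq_eq w]
  simp only [pdForward, projX_mk, projP_mk, projQ_mk, projZ_mk, projY_mk, projV_mk, zero_add,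
    norm_neg, Finset.sum_add_distrib, mul_add, Finset.mul_sum]
  have hx : ∑ i, ‖L i (projX w)‖ ^ 2 ≤ s * ‖projX w‖ ^ 2 :=
    calc _ ≤ ∑ i, ‖L i‖ ^ 2 * ‖projX w‖ ^ 2 :=
          Finset.sum_le_sum fun i _ => norm_clm_apply_sq_le _ le_rfl _
      _ = (∑ i, ‖L i‖ ^ 2) * ‖projX w‖ ^ 2 := (Finset.sum_mul _ _ _).symm
      _ ≤ _ := by gcongr
  have hv := norm_sum_adjoint_sq_le L hL fun i => projV i w
  rw [Finset.mul_sum] at hv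
  have hz := Finset.sum_le_sum fun i (_ : i ∈ Finset.univ) =>
    norm_clm_apply_sq_le (K i) (hK i) (projZ i w)
  have hy := Finset.sum_le_sum fun i (_ : i ∈ Finset.univ) =>
    norm_clm_apply_sq_le (M i) (hM i) (projY i w)
  have hp := Finset.sum_le_sum fun i (_ : i ∈ Finset.univ) =>
    norm_clm_apply_sq_le (adjoint (K i)) (s := s)
      (by rw [LinearIsometryEquiv.norm_map]; exact hK i) (projP i w)
  have hq := Finset.sum_le_sum fun i (_ : i ∈ Finset.univ) =>
    norm_clm_apply_sq_le (adjoint (M i)) (s := s)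
      (by rw [LinearIsometryEquiv.norm_map]; exact hM i) (projQ i w)
  linarith

theorem norm_pdForward_sub_le {h' : H → H} {L : ∀ i, H →L[ℝ] G i} {K : ∀ i, G i →L[ℝ] X i}
    {M : ∀ i, G i →L[ℝ] Y i} {μ s : ℝ} (hμ : 0 ≤ μ)
    (hlip : ∀ x y : H, ‖h' x - h' y‖ ≤ μ * ‖x - y‖)
    (hL : ∑ i, ‖L i‖ ^ 2 ≤ s) (hK : ∀ i, ‖K i‖ ^ 2 ≤ s) (hM : ∀ i, ‖M i‖ ^ 2 ≤ s)
    (a b : PDSpace H X Y G) :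
    ‖pdForward h' L K M a - pdForward h' L K M b‖ ≤ (μ + √s) * ‖a - b‖ := by
  have heq : pdForward h' L K M a - pdForward h' L K M b =
      mk (h' (projX a) - h' (projX b)) 0 0 0 0 0 + pdForward (fun _ => 0) L K M (a - b) := by
    apply ext_proj <;> intros <;>
      simp only [pdForward, map_add, map_sub, projX_mk, projP_mk, projQ_mk, projZ_mk, projY_mk,
        projV_mk, Finset.sum_sub_distrib, Pi.zero_apply] <;> abel
  have h1 : ‖(mk (h' (projX a) - h' (projX b)) 0 0 0 0 0 : PDSpace H X Y G)‖ ≤ μ * ‖a - b‖ := by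
    refine (norm_le _).trans ?_
    simp only [projX_mk, projP_mk, projQ_mk, projZ_mk, projY_mk, projV_mk, Pi.zero_apply,
      norm_zero, add_zero, Finset.sum_const_zero]
    refine (hlip _ _).trans ?_
    rw [← map_sub]
    gcongr
    exact norm_projX_le _
  rw [heq, add_mul]
  exact (norm_add_le _ _).trans (add_le_add h1 (norm_pdForward_zero_le L K M hL hK hM _))

variable
    {z : H} {f : H → EReal} {h : H → ℝ} {h' : H → H}
    {g : ∀ i, X i → EReal} {l : ∀ i, Y i → EReal} {r : ∀ i, G i}
    {L : ∀ i, H →L[ℝ] G i} {K : ∀ i, G i →L[ℝ] X i} {M : ∀ i, G i →L[ℝ] Y i}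

/-- The primal-dual monotone inclusion: `u` belongs to the image of `w` under the sum of
`pdForward` and of the subdifferentials of `f`, `g i ^*` and `l i ^*`, shifted by `z` and `r`. -/
def PDInclusion (z : H) (f : H → EReal) (h' : H → H) (g : ∀ i, X i → EReal)
    (l : ∀ i, Y i → EReal) (r : ∀ i, G i) (L : ∀ i, H →L[ℝ] G i) (K : ∀ i, G i →L[ℝ] X i)
    (M : ∀ i, G i →L[ℝ] Y i) (w u : PDSpace H X Y G) : Prop :=
  projX u - h' (projX w) - ∑ i, adjoint (L i) (projV i w) + z ∈ esubdiff f (projX w) ∧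
  (∀ i, projP i u + K i (projZ i w) ∈ esubdiff (econj (g i)) (projP i w)) ∧
  (∀ i, projQ i u + M i (projY i w) ∈ esubdiff (econj (l i)) (projQ i w)) ∧
  (∀ i, projZ i u = adjoint (K i) (projP i w) - projV i w) ∧
  (∀ i, projY i u = adjoint (M i) (projQ i w) - projV i w) ∧
  ∀ i, projV i u = r i + projZ i w + projY i w - L i (projX w)

theorem inner_eq_of_linear {w u : PDSpace H X Y G}
    (hz : ∀ i, projZ i u = adjoint (K i) (projP i w) - projV i w)
    (hy : ∀ i, projY i u = adjoint (M i) (projQ i w) - projV i w)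
    (hv : ∀ i, projV i u = r i + projZ i w + projY i w - L i (projX w)) (z d : H) :
    ⟪projX u - d - ∑ i, adjoint (L i) (projV i w) + z, projX w⟫ + ⟪d, projX w⟫ +
      ∑ i, (⟪projP i u + K i (projZ i w), projP i w⟫ +
        ⟪projQ i u + M i (projY i w), projQ i w⟫) =
    ⟪u, w⟫ + ⟪z, projX w⟫ - ∑ i, ⟪r i, projV i w⟫ := by
  have key : ∀ i, ⟪projP i u + K i (projZ i w), projP i w⟫ +
      ⟪projQ i u + M i (projY i w), projQ i w⟫ =
      ⟪projP i u, projP i w⟫ + ⟪projQ i u, projQ i w⟫ + ⟪projZ i u, projZ i w⟫ +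
        ⟪projY i u, projY i w⟫ + ⟪projV i u, projV i w⟫ +
        (⟪adjoint (L i) (projV i w), projX w⟫ - ⟪r i, projV i w⟫) := by
    intro i
    rw [hz, hy, hv]
    simp only [inner_add_left, inner_sub_left, adjoint_inner_left]
    rw [real_inner_comm (projP i w) (K i _), real_inner_comm (projQ i w) (M i _),
      real_inner_comm (projV i w) (projZ i w), real_inner_comm (projV i w) (projY i w),
      real_inner_comm (projV i w) (L i _)]
    ring
  rw [Finset.sum_congr rfl fun i _ => key i, Finset.sum_add_distrib, Finset.sum_sub_distrib,
    inner_eq u w, ← sum_inner]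
  simp only [inner_add_left, inner_sub_left]
  ring

theorem PDInclusion.monotone (hh : ProperConvLsc fun x => (h x : EReal))
    (hgrad : ∀ x, HasGradientAt h (h' x) x) {a b u : PDSpace H X Y G}
    (ha : PDInclusion z f h' g l r L K M a u) (hb : PDInclusion z f h' g l r L K M b 0) :
    0 ≤ ⟪u, a - b⟫ := by
  obtain ⟨ax, ap, aq, az, ay, av⟩ := ha
  obtain ⟨bx, bp, bq, bz, bY, bv⟩ := hb
  simp only [map_zero] at bx bp bq bz bY bv
  have key := inner_eq_of_linear (w := a - b) (u := u) (K := K) (M := M) (L := L) (r := 0)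
    (fun i => by
      rw [map_sub, map_sub, map_sub, az]
      refine sub_eq_zero.mp (Eq.trans ?_ (bz i).symm)
      abel)
    (fun i => by
      rw [map_sub, map_sub, map_sub, ay]
      refine sub_eq_zero.mp (Eq.trans ?_ (bY i).symm)
      abel)
    (fun i => by
      simp only [map_sub, av, Pi.zero_apply]
      refine sub_eq_zero.mp (Eq.trans ?_ (bv i).symm)
      abel)
    0 (h' (projX a) - h' (projX b))
  simp only [Pi.zero_apply, inner_zero_left, Finset.sum_const_zero, add_zero, sub_zero] at key
  rw [← key]
  have h1 := esubdiff_monotone ax bx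
  have h2 := esubdiff_monotone (gradient_mem_esubdiff hh (hgrad (projX a)))
    (gradient_mem_esubdiff hh (hgrad (projX b)))
  refine add_nonneg (add_nonneg ?_ ?_) (Finset.sum_nonneg fun i _ => add_nonneg ?_ ?_)
  · refine h1.trans_eq (congrArg₂ _ ?_ (map_sub _ _ _).symm)
    simp only [map_sub, Finset.sum_sub_distrib]
    abel
  · rwa [map_sub]
  · refine (esubdiff_monotone (ap i) (bp i)).trans_eq (congrArg₂ _ ?_ (map_sub _ _ _).symm)
    simp only [map_sub]
    abel
  · refine (esubdiff_monotone (aq i) (bq i)).trans_eq (congrArg₂ _ ?_ (map_sub _ _ _).symm)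
    simp only [map_sub]
    abel

theorem PDInclusion.weak_closed (hf : ProperConvLsc f) (hh : ProperConvLsc fun x => (h x : EReal))
    (hgrad : ∀ x, HasGradientAt h (h' x) x) {μ : ℝ}
    (hlip : ∀ x y : H, ‖h' x - h' y‖ ≤ μ * ‖x - y‖)
    (hg : ∀ i, ProperConvLsc (g i)) (hl : ∀ i, ProperConvLsc (l i)) {U : Ultrafilter ℕ}
    {a u : ℕ → PDSpace H X Y G} {b : PDSpace H X Y G} {C : ℝ} (hC : ∀ n, ‖a n‖ ≤ C)
    (hau : ∀ n, PDInclusion z f h' g l r L K M (a n) (u n)) (hu : Tendsto u U (𝓝 0))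
    (hab : UWConv U a b) : PDInclusion z f h' g l r L K M b 0 := by
  have hu0 := UWConv.of_tendsto hu
  have hz : ∀ i, projZ i (0 : PDSpace H X Y G) = adjoint (K i) (projP i b) - projV i b := fun i =>
    (hu0.clm (projZ i)).unique (by
      simpa only [fun n => (hau n).2.2.2.1 i] using
        ((hab.clm (projP i)).clm (adjoint (K i))).sub (hab.clm (projV i)))
  have hy : ∀ i, projY i (0 : PDSpace H X Y G) = adjoint (M i) (projQ i b) - projV i b := fun i =>
    (hu0.clm (projY i)).unique (by
      simpa only [fun n => (hau n).2.2.2.2.1 i] using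
        ((hab.clm (projQ i)).clm (adjoint (M i))).sub (hab.clm (projV i)))
  have hv : ∀ i, projV i (0 : PDSpace H X Y G) =
      r i + projZ i b + projY i b - L i (projX b) := fun i =>
    (hu0.clm (projV i)).unique (by
      simpa only [fun n => (hau n).2.2.2.2.2 i] using
        (((UWConv.of_tendsto tendsto_const_nhds).add (hab.clm (projZ i))).add
          (hab.clm (projY i))).sub ((hab.clm projX).clm (L i)))
  have Oa : a =O[(U : Filter ℕ)] fun _ => (1 : ℝ) :=
    Asymptotics.IsBigO.of_bound C (Eventually.of_forall fun n => by simpa using hC n)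
  have Ou : u =O[(U : Filter ℕ)] fun _ => (1 : ℝ) := hu.isBigO_one ℝ
  have Ox := isBigO_one_clm Oa projX
  have Oh : (fun n => h' (projX (a n))) =O[(U : Filter ℕ)] fun _ => (1 : ℝ) := by
    have h1 : (fun n => h' (projX (a n)) - h' 0) =O[(U : Filter ℕ)] fun n => projX (a n) :=
      Asymptotics.IsBigO.of_bound μ (Eventually.of_forall fun n => by
        simpa using hlip (projX (a n)) 0)
    simpa using (h1.trans Ox).add (Asymptotics.isBigO_const_const (h' 0) one_ne_zero _)
  obtain ⟨D, hD⟩ := Oh.bound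
  obtain ⟨d, hd⟩ := exists_uWConv U (fun n => h' (projX (a n))) (C := D) (by simpa using hD)
  have Os : (fun n => projX (u n) - h' (projX (a n)) - ∑ i, adjoint (L i) (projV i (a n)) + z)
      =O[(U : Filter ℕ)] fun _ => (1 : ℝ) :=
    (((isBigO_one_clm Ou projX).sub Oh).sub (Asymptotics.IsBigO.fun_sum fun i _ =>
      isBigO_one_clm (isBigO_one_clm Oa (projV i)) (adjoint (L i)))).add
      (Asymptotics.isBigO_const_const z one_ne_zero _)
  obtain ⟨κf, hκf⟩ := exists_tendsto_inner_of_isBigO Os Ox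
  obtain ⟨κh, hκh⟩ := exists_tendsto_inner_of_isBigO Oh Ox
  have Op : ∀ i, ∃ κ, Tendsto (fun n => ⟪projP i (u n) + K i (projZ i (a n)), projP i (a n)⟫) U
      (𝓝 κ) := fun i => exists_tendsto_inner_of_isBigO
    ((isBigO_one_clm Ou (projP i)).add (isBigO_one_clm (isBigO_one_clm Oa (projZ i)) (K i)))
    (isBigO_one_clm Oa (projP i))
  have Oq : ∀ i, ∃ κ, Tendsto (fun n => ⟪projQ i (u n) + M i (projY i (a n)), projQ i (a n)⟫) U
      (𝓝 κ) := fun i => exists_tendsto_inner_of_isBigO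
    ((isBigO_one_clm Ou (projQ i)).add (isBigO_one_clm (isBigO_one_clm Oa (projY i)) (M i)))
    (isBigO_one_clm Oa (projQ i))
  choose κp hκp using Op
  choose κq hκq using Oq
  have hsum : κf + κh + ∑ i, (κp i + κq i) =
      ⟪projX (0 : PDSpace H X Y G) - d - ∑ i, adjoint (L i) (projV i b) + z, projX b⟫ + ⟪d, projX b⟫ +
      ∑ i, (⟪projP i (0 : PDSpace H X Y G) + K i (projZ i b), projP i b⟫ +
        ⟪projQ i (0 : PDSpace H X Y G) + M i (projY i b), projQ i b⟫) := by
    refine tendsto_nhds_unique ((hκf.add hκh).add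
      (tendsto_finsetSum Finset.univ fun i _ => (hκp i).add (hκq i))) ?_
    rw [inner_eq_of_linear hz hy hv z d, inner_zero_left]
    simp only [fun n => inner_eq_of_linear (hau n).2.2.2.1 (hau n).2.2.2.2.1 (hau n).2.2.2.2.2 z
      (h' (projX (a n)))]
    refine ((tendsto_inner_zero hu hC).add ?_).sub (tendsto_finsetSum _ fun i _ => ?_)
    · simpa only [real_inner_comm] using hab.clm projX z
    · simpa only [real_inner_comm] using hab.clm (projV i) (r i)
  have cf := hf.hasAffineMinorants.subdiff_weak_limit hf.2.1 (fun n => (hau n).1) (hab.clm projX)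
    ((((hu0.clm projX).sub hd).sub (UWConv.sum fun i =>
      (hab.clm (projV i)).clm (adjoint (L i)))).add (UWConv.of_tendsto tendsto_const_nhds)) hκf
  have ch := hh.hasAffineMinorants.subdiff_weak_limit hh.2.1
    (fun n => gradient_mem_esubdiff hh (hgrad (projX (a n)))) (hab.clm projX) hd hκh
  have cp := fun i => (hasAffineMinorants_econj (hg i).2.1).subdiff_weak_limit
    (econj_ne_bot (hg i).1 (hg i).2.1) (fun n => (hau n).2.1 i) (hab.clm (projP i))
    ((hu0.clm (projP i)).add ((hab.clm (projZ i)).clm (K i))) (hκp i)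
  have cq := fun i => (hasAffineMinorants_econj (hl i).2.1).subdiff_weak_limit
    (econj_ne_bot (hl i).1 (hl i).2.1) (fun n => (hau n).2.2.1 i) (hab.clm (projQ i))
    ((hu0.clm (projQ i)).add ((hab.clm (projY i)).clm (M i))) (hκq i)
  have hle : ∀ i ∈ Finset.univ, ⟪projP i (0 : PDSpace H X Y G) + K i (projZ i b), projP i b⟫ +
      ⟪projQ i (0 : PDSpace H X Y G) + M i (projY i b), projQ i b⟫ ≤ κp i + κq i :=
    fun i _ => add_le_add (cp i).1 (cq i).1
  have hS := Finset.sum_le_sum hle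
  have heq := (Finset.sum_eq_sum_iff_of_le hle).mp (by linarith [cf.1, ch.1])
  have hdb : d = h' (projX b) :=
    eq_gradient_of_mem_esubdiff (hgrad _) (ch.2 (by linarith [cf.1]))
  refine ⟨hdb ▸ cf.2 (by linarith [ch.1]), fun i => (cp i).2 ?_, fun i => (cq i).2 ?_, hz, hy, hv⟩
  · linarith [heq i (Finset.mem_univ i), (cq i).1]
  · linarith [heq i (Finset.mem_univ i), (cp i).1]


theorem PDInclusion.exists_zero
    (hran : ∃ (x : H) (u : H) (w : ∀ i, G i), u ∈ esubdiff f x ∧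
      (∀ i, w i ∈ parOp (compOp (K i) (esubdiff (g i))) (compOp (M i) (esubdiff (l i)))
        (L i x - r i)) ∧
      z = u + ∑ i, adjoint (L i) (w i) + h' x) :
    ∃ a, PDInclusion z f h' g l r L K M a 0 := by
  obtain ⟨x, u, w, hu, hw, hz⟩ := hran
  choose a ha b hb hab using hw
  choose p hp hpw using ha
  choose q hq hqw using hb
  refine ⟨mk x p q a b w, ?_, fun i => ?_, fun i => ?_, fun i => ?_, fun i => ?_, fun i => ?_⟩ <;>
    simp only [map_zero, zero_add, projX_mk, projP_mk, projQ_mk, projZ_mk, projY_mk, projV_mk]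
  · convert hu using 1
    rw [hz]
    abel
  · exact mem_esubdiff_econj (hp i)
  · exact mem_esubdiff_econj (hq i)
  · rw [hpw, sub_self]
  · rw [hqw, sub_self]
  · rw [add_assoc, ← hab, add_sub_cancel, sub_self]

theorem PDInclusion.optimal (hh : ProperConvLsc fun x => (h x : EReal))
    (hgrad : ∀ x, HasGradientAt h (h' x) x) (hg : ∀ i, ProperConvLsc (g i))
    (hl : ∀ i, ProperConvLsc (l i)) {a : PDSpace H X Y G}
    (ha : PDInclusion z f h' g l r L K M a 0) :
    (∀ x, Pval z f h g l r L K M (projX a) ≤ Pval z f h g l r L K M x) ∧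
    (∀ i, adjoint (K i) (projP i a) = adjoint (M i) (projQ i a)) ∧
    ∀ (p : ∀ i, X i) (q : ∀ i, Y i), (∀ i, adjoint (K i) (p i) = adjoint (M i) (q i)) →
      Dval z f h g l r L K M p q ≤
        Dval z f h g l r L K M (fun i => projP i a) (fun i => projQ i a) := by
  obtain ⟨hx, hp, hq, hz, hy, hv⟩ := ha
  simp only [map_zero, zero_add] at hx hp hq hz hy hv
  have hz' := fun i => (sub_eq_zero.mp (hz i).symm)
  have hy' := fun i => (sub_eq_zero.mp (hy i).symm)
  have h1 := primal_dual_optimal (z := z) (f := f) (h := h) (h' := h') (g := g) (l := l) (r := r)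
    (L := L) (K := K) (M := M) (xb := projX a) (pb := fun i => projP i a)
    (qb := fun i => projQ i a) (vb := fun i => projV i a) (zb := fun i => projZ i a)
    (yb := fun i => projY i a) (by convert hx using 1; abel)
    (gradient_mem_esubdiff hh (hgrad _))
    (fun i => (hg i).hasAffineMinorants.mem_esubdiff_of_econj (hg i).2.1 (hp i))
    (fun i => (hl i).hasAffineMinorants.mem_esubdiff_of_econj (hl i).2.1 (hq i)) hz' hy'
    (fun i => by
      refine (sub_eq_zero.mp ((?_ : _ = _).trans (hv i).symm)).symm
      abel)
  exact ⟨h1.1, fun i => (hz' i).trans (hy' i).symm, h1.2⟩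

theorem PDInclusion.of_resolvent {γ : ℝ} (hγ : 0 < γ) {w : PDSpace H X Y G}
    {jx : H} {jp : ∀ i, X i} {jq : ∀ i, Y i} {jz jy jv a b : ∀ i, G i}
    (hx : γ⁻¹ • (projX w - γ • (h' (projX w) + ∑ i, adjoint (L i) (projV i w) - z) - jx) ∈
      esubdiff f jx)
    (hp : ∀ i, γ⁻¹ • (projP i w + γ • K i (projZ i w) - jp i) ∈ esubdiff (econj (g i)) (jp i))
    (hq : ∀ i, γ⁻¹ • (projQ i w + γ • M i (projY i w) - jq i) ∈ esubdiff (econj (l i)) (jq i))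
    (ha : ∀ i, a i = projZ i w - γ • (adjoint (K i) (projP i w) - projV i w -
      γ • (L i (projX w) - r i)))
    (hb : ∀ i, b i = projY i w - γ • (adjoint (M i) (projQ i w) - projV i w -
      γ • (L i (projX w) - r i)))
    (hz : ∀ i, jz i = ((1 + γ ^ 2) / (1 + 2 * γ ^ 2)) • (a i - (γ ^ 2 / (1 + γ ^ 2)) • b i))
    (hy : ∀ i, jy i = (1 / (1 + γ ^ 2)) • (b i - γ ^ 2 • jz i))
    (hv : ∀ i, jv i = projV i w + γ • (L i (projX w) - r i - jz i - jy i)) :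
    PDInclusion z f h' g l r L K M (mk jx jp jq jz jy jv)
      (γ⁻¹ • (w - mk jx jp jq jz jy jv) -
        (pdForward h' L K M w - pdForward h' L K M (mk jx jp jq jz jy jv))) := by
  have hγ0 := hγ.ne'
  refine ⟨?_, fun i => ?_, fun i => ?_, fun i => ?_, fun i => ?_, fun i => ?_⟩ <;>
    simp only [pdForward, map_sub, map_smul, projX_mk, projP_mk, projQ_mk, projZ_mk, projY_mk,
      projV_mk]
  · convert hx using 1
    simp only [smul_sub, inv_smul_smul₀ hγ0]
    abel
  · convert hp i using 1
    simp only [smul_sub, smul_add, inv_smul_smul₀ hγ0]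
    abel
  · convert hq i using 1
    simp only [smul_sub, smul_add, inv_smul_smul₀ hγ0]
    abel
  · have h1 := (coupled_resolvent (hz i) (hy i)).1
    have h2 : projZ i w - jz i = γ • (adjoint (K i) (projP i w) - jv i) := by
      rw [hv]
      rw [ha] at h1
      refine sub_eq_zero.mp (Eq.trans ?_ (sub_eq_zero.mpr h1))
      module
    rw [h2, inv_smul_smul₀ hγ0]
    abel
  · have h1 := (coupled_resolvent (hz i) (hy i)).2
    have h2 : projY i w - jy i = γ • (adjoint (M i) (projQ i w) - jv i) := by
      rw [hv]
      rw [hb] at h1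
      refine sub_eq_zero.mp (Eq.trans ?_ (sub_eq_zero.mpr h1))
      module
    rw [h2, inv_smul_smul₀ hγ0]
    abel
  · rw [hv]
    simp only [sub_add_cancel_left, smul_neg, inv_smul_smul₀ hγ0]
    abel

end PrimalDual

theorem stmt16 {m : ℕ}
    {H : Type*} [NormedAddCommGroup H] [InnerProductSpace ℝ H] [CompleteSpace H]
    {G : Fin m → Type*} [∀ i, NormedAddCommGroup (G i)] [∀ i, InnerProductSpace ℝ (G i)]
    [∀ i, CompleteSpace (G i)]
    {X : Fin m → Type*} [∀ i, NormedAddCommGroup (X i)] [∀ i, InnerProductSpace ℝ (X i)]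
    [∀ i, CompleteSpace (X i)]
    {Y : Fin m → Type*} [∀ i, NormedAddCommGroup (Y i)] [∀ i, InnerProductSpace ℝ (Y i)]
    [∀ i, CompleteSpace (Y i)]
    (z : H)
    (f : H → EReal) (hf : ProperConvLsc f)
    (μ : ℝ) (hμ : 0 < μ)
    (h : H → ℝ) (hh : ProperConvLsc (fun x => (h x : EReal)))
    (h' : H → H) (hgrad : ∀ x, HasGradientAt h (h' x) x)
    (hlip : ∀ x y : H, ‖h' x - h' y‖ ≤ μ * ‖x - y‖)
    (r : ∀ i, G i)
    (g : ∀ i, X i → EReal) (hg : ∀ i, ProperConvLsc (g i))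
    (l : ∀ i, Y i → EReal) (hl : ∀ i, ProperConvLsc (l i))
    (L : ∀ i, H →L[ℝ] G i) (hL : ∀ i, L i ≠ 0)
    (K : ∀ i, G i →L[ℝ] X i) (hK : ∀ i, K i ≠ 0)
    (M : ∀ i, G i →L[ℝ] Y i) (hM : ∀ i, M i ≠ 0)
    -- range condition
    (hran : ∃ (x : H) (u : H) (w : ∀ i, G i), u ∈ esubdiff f x ∧
        (∀ i, w i ∈ parOp (compOp (K i) (esubdiff (g i))) (compOp (M i) (esubdiff (l i)))
          (L i x - r i)) ∧
        z = u + ∑ i, ContinuousLinearMap.adjoint (L i) (w i) + h' x)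
    -- the constant β
    (β : ℝ)
    (hβ : ∃ s : ℝ, IsGreatest ({∑ i, ‖L i‖ ^ 2} ∪ Set.range (fun j => ‖K j‖ ^ 2) ∪
        Set.range (fun j => ‖M j‖ ^ 2)) s ∧ β = μ + Real.sqrt s)
    -- step sizes
    (ε : ℝ) (hε : ε ∈ Set.Ioo (0:ℝ) (1 / (β + 1)))
    (γ : ℕ → ℝ) (hγ : ∀ n, γ n ∈ Set.Icc ε ((1 - ε) / β))
    -- the sequences generated by Algorithm 4.6
    (x xt : ℕ → H)
    (p pt : ℕ → ∀ i, X i) (q qt : ℕ → ∀ i, Y i)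
    (zz zt y yt v vt u1 u2 : ℕ → ∀ i, G i)
    (hxt : ∃ j : ℕ → H,
      (∀ n, IsProx (γ n) f
        (x n - γ n • (h' (x n) + ∑ i, ContinuousLinearMap.adjoint (L i) (v n i) - z)) (j n)) ∧
      Summable (fun n => ‖xt n - j n‖))
    (hpt : ∀ i, ∃ j : ℕ → X i,
      (∀ n, IsProx (γ n) (econj (g i)) (p n i + γ n • K i (zz n i)) (j n)) ∧
      Summable (fun n => ‖pt n i - j n‖))
    (hqt : ∀ i, ∃ j : ℕ → Y i,
      (∀ n, IsProx (γ n) (econj (l i)) (q n i + γ n • M i (y n i)) (j n)) ∧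
      Summable (fun n => ‖qt n i - j n‖))
    (hu1 : ∀ i, Summable (fun n => ‖u1 n i - (zz n i - γ n •
        (ContinuousLinearMap.adjoint (K i) (p n i) - v n i - γ n • (L i (x n) - r i)))‖))
    (hu2 : ∀ i, Summable (fun n => ‖u2 n i - (y n i - γ n •
        (ContinuousLinearMap.adjoint (M i) (q n i) - v n i - γ n • (L i (x n) - r i)))‖))
    (hzt : ∀ i, Summable (fun n => ‖zt n i -
        ((1 + γ n ^ 2) / (1 + 2 * γ n ^ 2)) •
          (u1 n i - (γ n ^ 2 / (1 + γ n ^ 2)) • u2 n i)‖))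
    (hyt : ∀ i, Summable (fun n => ‖yt n i -
        (1 / (1 + γ n ^ 2)) • (u2 n i - γ n ^ 2 • zt n i)‖))
    (hvt : ∀ i, Summable (fun n => ‖vt n i -
        (v n i + γ n • (L i (x n) - r i - zt n i - yt n i))‖))
    (hx : Summable (fun n => ‖x (n+1) - (xt n + γ n • (h' (x n) - h' (xt n) +
        ∑ i, ContinuousLinearMap.adjoint (L i) (v n i - vt n i)))‖))
    (hp : ∀ i, Summable (fun n => ‖p (n+1) i - (pt n i - γ n • K i (zz n i - zt n i))‖))
    (hq : ∀ i, Summable (fun n => ‖q (n+1) i - (qt n i - γ n • M i (y n i - yt n i))‖))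
    (hz : ∀ i, Summable (fun n => ‖zz (n+1) i - (zt n i + γ n •
        ContinuousLinearMap.adjoint (K i) (p n i - pt n i))‖))
    (hy : ∀ i, Summable (fun n => ‖y (n+1) i - (yt n i + γ n •
        ContinuousLinearMap.adjoint (M i) (q n i - qt n i))‖))
    (hv : ∀ i, Summable (fun n => ‖v (n+1) i - (vt n i - γ n • L i (x n - xt n))‖))
    :
    ∃ (xb : H) (pb : ∀ i, X i) (qb : ∀ i, Y i),
      (∀ x' : H, Pval z f h g l r L K M xb ≤ Pval z f h g l r L K M x') ∧
      (∀ i, ContinuousLinearMap.adjoint (K i) (pb i) =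
          ContinuousLinearMap.adjoint (M i) (qb i)) ∧
      (∀ (p' : ∀ i, X i) (q' : ∀ i, Y i),
        (∀ i, ContinuousLinearMap.adjoint (K i) (p' i) =
          ContinuousLinearMap.adjoint (M i) (q' i)) →
        Dval z f h g l r L K M p' q' ≤ Dval z f h g l r L K M pb qb) ∧
      WConv x xb ∧ WConv xt xb ∧
      (∀ i, WConv (fun n => p n i) (pb i)) ∧ (∀ i, WConv (fun n => pt n i) (pb i)) ∧
      (∀ i, WConv (fun n => q n i) (qb i)) ∧ (∀ i, WConv (fun n => qt n i) (qb i)) := by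
  obtain ⟨hε0, hε1⟩ := hε
  obtain ⟨s, ⟨-, hs⟩, rfl⟩ := hβ
  have hLs : ∑ i, ‖L i‖ ^ 2 ≤ s := hs (Or.inl (Or.inl rfl))
  have hKs : ∀ i, ‖K i‖ ^ 2 ≤ s := fun i => hs (Or.inl (Or.inr ⟨i, rfl⟩))
  have hMs : ∀ i, ‖M i‖ ^ 2 ≤ s := fun i => hs (Or.inr ⟨i, rfl⟩)
  have hQ := norm_pdForward_sub_le hμ.le hlip hLs hKs hMs
  have hβ0 : 0 < μ + √s := by positivity
  generalize μ + √s = β at hε1 hγ hQ hβ0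
  have hε1' : ε < 1 := hε1.trans (by rw [div_lt_one (by positivity)]; linarith)
  have hγ0 : ∀ n, 0 < γ n := fun n => hε0.trans_le (hγ n).1
  have hγβ : ∀ n, γ n * β ≤ 1 - ε := fun n => (le_div_iff₀ hβ0).mp (hγ n).2
  have hγB : ∀ n, |-γ n| ≤ (1 - ε) / β := fun n => by
    rw [abs_neg, abs_of_pos (hγ0 n)]
    exact (hγ n).2
  obtain ⟨jx, hjx, sx⟩ := hxt
  choose jp hjp sp using hpt
  choose jq hjq sq using hqt
  obtain ⟨a₀, ha₀⟩ := PDInclusion.exists_zero hran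
  let a : ℕ → ∀ i, G i := fun n i => zz n i - γ n •
    (ContinuousLinearMap.adjoint (K i) (p n i) - v n i - γ n • (L i (x n) - r i))
  let b : ℕ → ∀ i, G i := fun n i => y n i - γ n •
    (ContinuousLinearMap.adjoint (M i) (q n i) - v n i - γ n • (L i (x n) - r i))
  let jz : ℕ → ∀ i, G i := fun n i => ((1 + γ n ^ 2) / (1 + 2 * γ n ^ 2)) •
    (a n i - (γ n ^ 2 / (1 + γ n ^ 2)) • b n i)
  let jy : ℕ → ∀ i, G i := fun n i => (1 / (1 + γ n ^ 2)) • (b n i - γ n ^ 2 • jz n i)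
  let jv : ℕ → ∀ i, G i := fun n i => v n i + γ n • (L i (x n) - r i - jz n i - jy n i)
  let w : ℕ → PDSpace H X Y G := fun n => PDSpace.mk (x n) (p n) (q n) (zz n) (y n) (v n)
  let wt : ℕ → PDSpace H X Y G := fun n => PDSpace.mk (xt n) (pt n) (qt n) (zt n) (yt n) (vt n)
  let J : ℕ → PDSpace H X Y G := fun n =>
    PDSpace.mk (jx n) (fun i => jp i n) (fun i => jq i n) (jz n) (jy n) (jv n)
  have hR : ∀ n, PDInclusion z f h' g l r L K M (J n)
      ((γ n)⁻¹ • (w n - J n) - (pdForward h' L K M (w n) - pdForward h' L K M (J n))) := fun n =>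
    PDInclusion.of_resolvent (hγ0 n)
      (mem_esubdiff_of_isProx hf.hasAffineMinorants hf.2.1 hf.1 (hγ0 n) (hjx n))
      (fun i => mem_esubdiff_of_isProx (hasAffineMinorants_econj (hg i).2.1)
        (econj_ne_bot (hg i).1 (hg i).2.1) ⟨_, (ha₀.2.1 i).1⟩ (hγ0 n) (hjp i n))
      (fun i => mem_esubdiff_of_isProx (hasAffineMinorants_econj (hl i).2.1)
        (econj_ne_bot (hl i).1 (hl i).2.1) ⟨_, (ha₀.2.2.1 i).1⟩ (hγ0 n) (hjq i n))
      (fun i => rfl) (fun i => rfl) (fun i => rfl) (fun i => rfl) (fun i => rfl)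
  have sz : ∀ i, Summable fun n => ‖zt n i - jz n i‖ := fun i =>
    summable_norm_of_eq_add_smul (C := 1) (D := 1)
      (c := fun n => (1 + γ n ^ 2) / (1 + 2 * γ n ^ 2))
      (d := fun n => -((1 + γ n ^ 2) / (1 + 2 * γ n ^ 2) * (γ n ^ 2 / (1 + γ n ^ 2))))
      (fun n => by
        rw [abs_of_nonneg (by positivity), div_le_one (by positivity)]
        linarith [sq_nonneg (γ n)])
      (fun n => by
        rw [abs_neg, abs_of_nonneg (by positivity), div_mul_div_cancel₀' (by positivity),
          div_le_one (by positivity)]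
        linarith [sq_nonneg (γ n)])
      (hzt i) (hu1 i) (hu2 i) (fun n => by
        simp only [jz, a, b]
        module)
  have sy : ∀ i, Summable fun n => ‖yt n i - jy n i‖ := fun i =>
    summable_norm_of_eq_add_smul (C := 1) (D := 1)
      (c := fun n => 1 / (1 + γ n ^ 2)) (d := fun n => -(1 / (1 + γ n ^ 2) * γ n ^ 2))
      (fun n => by
        rw [abs_of_nonneg (by positivity), div_le_one (by positivity)]
        linarith [sq_nonneg (γ n)])
      (fun n => by
        rw [abs_neg, abs_of_nonneg (by positivity), one_div_mul_eq_div,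
          div_le_one (by positivity)]
        linarith [sq_nonneg (γ n)])
      (hyt i) (hu2 i) (sz i) (fun n => by
        simp only [jy, b]
        module)
  have sv : ∀ i, Summable fun n => ‖vt n i - jv n i‖ := fun i =>
    summable_norm_of_eq_add_smul hγB hγB (hvt i) (sz i) (sy i) (fun n => by
      simp only [jv]
      module)
  have sJ : Summable fun n => ‖wt n - J n‖ :=
    PDSpace.summable_norm (by simpa [wt, J] using sx) (by simpa [wt, J] using sp)
      (by simpa [wt, J] using sq) (by simpa [wt, J] using sz) (by simpa [wt, J] using sy)
      (by simpa [wt, J] using sv)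
  have sQ : Summable fun n => ‖pdForward h' L K M (wt n) - pdForward h' L K M (J n)‖ :=
    Summable.of_nonneg_of_le (fun n => norm_nonneg _) (fun n => hQ _ _) (sJ.mul_left β)
  have sw : Summable fun n => ‖w (n + 1) -
      (wt n + γ n • (pdForward h' L K M (w n) - pdForward h' L K M (wt n)))‖ := by
    refine PDSpace.summable_norm ?_ (fun i => ?_) (fun i => ?_) (fun i => ?_) (fun i => ?_)
      (fun i => ?_) <;>
      simp only [w, wt, pdForward, map_sub, map_add, map_smul, PDSpace.projX_mk, PDSpace.projP_mk, PDSpace.projQ_mk,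
        PDSpace.projZ_mk, PDSpace.projY_mk, PDSpace.projV_mk]
    · convert hx using 4 with n
      simp only [map_sub, Finset.sum_sub_distrib]
      module
    · convert hp i using 4 with n
      simp only [map_sub]
      module
    · convert hq i using 4 with n
      simp only [map_sub]
      module
    · simpa only [map_sub] using hz i
    · simpa only [map_sub] using hy i
    · convert hv i using 4 with n
      simp only [map_sub]
      module
  obtain ⟨c, hc, hwc, hJc⟩ := exists_wConv_of_forward_backward_forward hε0 hε1'
    (fun n => (hγ n).1) hγβ hQ hR (fun _ _ _ => PDInclusion.monotone hh hgrad)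
    (fun _ _ _ _ _ => PDInclusion.weak_closed hf hh hgrad hlip hg hl) ⟨a₀, ha₀⟩
    (summable_norm_of_eq_add_smul (C := 1) (c := fun _ => 1) (by simp) hγB sw sJ sQ
      (fun n => by module))
  have hwt : WConv wt c := hJc.of_norm_sub sJ.tendsto_atTop_zero
  obtain ⟨hP, hKM, hD⟩ := PDInclusion.optimal hh hgrad hg hl hc
  exact ⟨PDSpace.projX c, fun i => PDSpace.projP i c, fun i => PDSpace.projQ i c, hP, hKM, hD, hwc.clm PDSpace.projX,
    hwt.clm PDSpace.projX, fun i => hwc.clm (PDSpace.projP i), fun i => hwt.clm (PDSpace.projP i),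
    fun i => hwc.clm (PDSpace.projQ i), fun i => hwt.clm (PDSpace.projQ i)⟩
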